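/- arXiv:2107.03152 — 3 statements merged into one kernel-verified Lean document; each statement's English description precedes it below -/
import Mathlib

section
/- Let A,A',B,B',C,C' ⊆ [n] satisfy A∩A' = B∩B' = C∩C' = ∅ and |A| = |B'|+|C'|, |B| = |A'|+|C'|, |C| = |A'|+|B'|. Then the following are equivalent: (i) there exist subsets A_1,A_2,B_1,B_2,C_1,C_2 ⊆ [n] with |A_1| = |A_2| = |A'|, |B_1| = |B_2| = |B'|, |C_1| = |C_2| = |C'|, such that c^{τ(A')}_{τ(A_1),τ(A_2)}, c^{τ(B')}_{τ(B_1),τ(B_2)}, c^{τ(C')}_{τ(C_1),τ(C_2)} are all positive and c^{τ(A)}_{τ(B_1),τ(C_2)}, c^{τ(B)}_{τ(C_1),τ(A_2)}, c^{τ(C)}_{τ(A_1),τ(B_2)} are all positive; (ii) the multiple Newell–Littlewood number N_{τ(A'), τ(B), τ(C'), τ(A), τ(B'), τ(C)} is nonzero. -/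
/-- `f : ℕ → ℕ` is a partition: weakly decreasing and eventually zero
(the parts are `f 0 ≥ f 1 ≥ …`, 0-indexed). -/
def IsPartition (f : ℕ → ℕ) : Prop :=
  (∀ i j, i ≤ j → f j ≤ f i) ∧ ∃ N, ∀ i, N ≤ i → f i = 0

/-- The cell in row `i`, column `j` (0-indexed) lies in the skew shape `ν/λ`. -/
def InSkew (lam nu : ℕ → ℕ) (i j : ℕ) : Prop :=
  lam i ≤ j ∧ j < nu i

/-- `p` is read weakly before `q` in the row reading word of a (skew) tableau:
right to left along rows, top to bottom. -/
def ReadBefore (p q : ℕ × ℕ) : Prop :=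
  p.1 < q.1 ∨ (p.1 = q.1 ∧ q.2 ≤ p.2)

/-- `T` is a Littlewood–Richardson witness for `c^ν_{λ,μ}`: a semistandard skew
tableau of shape `ν/λ` (entries `≥ 1` on the shape, `0` off the shape) with
content `μ`, whose (reverse) row reading word is ballot.  The conditions that
`λ, μ, ν` are partitions with `λ ⊆ ν` are built in, so that the associated
count vanishes on non-partitions. -/
def IsLRTableau (lam mu nu : ℕ → ℕ) (T : ℕ → ℕ → ℕ) : Prop :=
  IsPartition lam ∧ IsPartition mu ∧ IsPartition nu ∧
  (∀ i, lam i ≤ nu i) ∧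
  (∀ i j, ¬ InSkew lam nu i j → T i j = 0) ∧
  (∀ i j, InSkew lam nu i j → 1 ≤ T i j) ∧
  (∀ i j j', InSkew lam nu i j → InSkew lam nu i j' → j ≤ j' → T i j ≤ T i j') ∧
  (∀ i i' j, InSkew lam nu i j → InSkew lam nu i' j → i < i' → T i j < T i' j) ∧
  (∀ k, {p : ℕ × ℕ | InSkew lam nu p.1 p.2 ∧ T p.1 p.2 = k + 1}.ncard = mu k) ∧
  (∀ k, ∀ q : ℕ × ℕ, InSkew lam nu q.1 q.2 → T q.1 q.2 = k + 2 →
    {p : ℕ × ℕ | InSkew lam nu p.1 p.2 ∧ T p.1 p.2 = k + 2 ∧ ReadBefore p q}.ncard ≤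
      {p : ℕ × ℕ | InSkew lam nu p.1 p.2 ∧ T p.1 p.2 = k + 1 ∧ ReadBefore p q}.ncard)

/-- The Littlewood–Richardson coefficient `c^ν_{λ,μ}` (inner shape `λ`,
content `μ`, outer shape `ν`). -/
noncomputable def lrCoeff (lam mu nu : ℕ → ℕ) : ℕ :=
  Nat.card {T : ℕ → ℕ → ℕ // IsLRTableau lam mu nu T}

/-- The Newell–Littlewood number `N_{λ,μ,ν} = ∑ c^λ_{α,β} c^μ_{β,γ} c^ν_{γ,α}`. -/
noncomputable def NL (lam mu nu : ℕ → ℕ) : ℕ :=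
  ∑ᶠ (a : ℕ → ℕ) (b : ℕ → ℕ) (c : ℕ → ℕ),
    lrCoeff a b lam * lrCoeff b c mu * lrCoeff c a nu

/-- Membership in `Par_n`: a partition with at most `n` parts. -/
def MemParN (n : ℕ) (f : ℕ → ℕ) : Prop :=
  IsPartition f ∧ ∀ i, n ≤ i → f i = 0

/-- `|λ_A| = ∑_{i ∈ A} λ_i` for `A ⊆ [n] = {1,…,n}` (1-indexed subset,
0-indexed parts). -/
def sumParts (f : ℕ → ℕ) (A : Finset ℕ) : ℕ := ∑ i ∈ A, f (i - 1)

/-- `|λ| = ∑ λ_i`. -/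
noncomputable def sizeP (f : ℕ → ℕ) : ℕ := ∑ᶠ i, f i
/-- The multiple Newell–Littlewood number
`N_{λ₁,…,λ₆} = ∑ ∏_{i ∈ ℤ/6ℤ} c^{λ_i}_{α_i,α_{i+1}}`. -/
noncomputable def NL6 (l1 l2 l3 l4 l5 l6 : ℕ → ℕ) : ℕ :=
  ∑ᶠ (a1 : ℕ → ℕ) (a2 : ℕ → ℕ) (a3 : ℕ → ℕ) (a4 : ℕ → ℕ) (a5 : ℕ → ℕ) (a6 : ℕ → ℕ),
    lrCoeff a1 a2 l1 * lrCoeff a2 a3 l2 * lrCoeff a3 a4 l3 *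
      lrCoeff a4 a5 l4 * lrCoeff a5 a6 l5 * lrCoeff a6 a1 l6
/-- The `k`-th smallest element of `A` (0-indexed `k`). -/
def nthSmall (A : Finset ℕ) (k : ℕ) : ℕ := (A.sort (· ≤ ·)).getD k 0

/-- `τ(A) = (i_r − r ≥ … ≥ i_1 − 1)` for `A = {i_1 < … < i_r}` (0-indexed parts). -/
def tauP (A : Finset ℕ) : ℕ → ℕ := fun k =>
  if k < A.card then nthSmall A (A.card - 1 - k) - (A.card - k) else 0

namespace LRS

def S (f : ℕ → ℕ) (r : ℕ) : ℕ := ∑ i ∈ Finset.range r, f i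

lemma S_zero (f : ℕ → ℕ) : S f 0 = 0 := by simp [S]
lemma S_succ (f : ℕ → ℕ) (r : ℕ) : S f (r+1) = S f r + f r := by simp [S, Finset.sum_range_succ]

lemma S_mono {f g : ℕ → ℕ} (h : ∀ i, f i ≤ g i) (r : ℕ) : S f r ≤ S g r :=
  Finset.sum_le_sum fun i _ => h i

lemma S_stable {f : ℕ → ℕ} {N : ℕ} (h : ∀ i, N ≤ i → f i = 0) : ∀ r, N ≤ r → S f r = S f N := by
  intro r hr
  induction r, hr using Nat.le_induction with
  | base => rfl
  | succ r hr ih => rw [S_succ, ih, h r hr]; rfl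

def Strip (a b : ℕ → ℕ) : Prop := ∀ i, a i ≤ b i ∧ b (i+1) ≤ a i
def Ballot (X Y Z : ℕ → ℕ) : Prop := ∀ r, S X r + S Z (r+1) ≤ S Y r + S Y (r+1)

def sw (a b c : ℕ → ℕ) : ℕ → ℕ
  | 0 => c 0 + max (c 1) (a 0) - b 0
  | (i+1) => min (c (i+1)) (a i) + max (c (i+2)) (a (i+1)) - b (i+1)

lemma sw_strip {a b c : ℕ → ℕ} (h1 : Strip a b) (h2 : Strip b c) :
    Strip a (sw a b c) ∧ Strip (sw a b c) c := by
  have key : ∀ i, max (c (i+1)) (a i) ≤ sw a b c i ∧ sw a b c i ≤ c i ∧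
      sw a b c (i+1) ≤ a i := by
    intro i
    have e1 := h1 i; have e2 := h2 i
    have e3 := h1 (i+1); have e4 := h2 (i+1)
    refine ⟨?_, ?_, ?_⟩
    · cases i with
      | zero => simp only [sw]; simp only [zero_add] at *; omega
      | succ i => have := h1 i; simp only [sw, show ∀ j : ℕ, j+1+1 = j+2 from fun _ => rfl] at *; omega
    · cases i with
      | zero => simp only [sw]; simp only [zero_add] at *; omega
      | succ i => have := h1 i; simp only [sw, show ∀ j : ℕ, j+1+1 = j+2 from fun _ => rfl] at *; omega
    · simp only [sw, show ∀ j : ℕ, j+1+1 = j+2 from fun _ => rfl] at *; omega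
  refine ⟨fun i => ⟨?_, (key i).2.2⟩, fun i => ⟨(key i).2.1, ?_⟩⟩
  · have := (key i).1; omega
  · have := (key i).1; omega

lemma sw_S {a b c : ℕ → ℕ} (h1 : Strip a b) (h2 : Strip b c) (r : ℕ) :
    S (sw a b c) (r+1) + S b (r+1) = max (S c (r+2) + S a r) (S c (r+1) + S a (r+1)) := by
  induction r with
  | zero =>
    have e1 := h1 0; have e2 := h2 0
    simp only [S_succ, S_zero, sw]
    simp only [zero_add] at *
    omega
  | succ r ih =>
    have e1 := h1 r; have e2 := h2 r
    have e3 := h1 (r+1); have e4 := h2 (r+1)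
    rw [S_succ (sw a b c) (r+1), S_succ b (r+1)]
    simp only [sw]
    rw [S_succ c (r+2), S_succ a (r+1)]
    rw [S_succ c (r+1), S_succ a r] at *
    omega

lemma ballot_push {α β γ δ : ℕ → ℕ} (h1 : Strip α β) (h2 : Strip β γ) (h3 : Strip γ δ)
    (hb : Ballot β γ δ) :
    Ballot α (sw α β γ) (sw (sw α β γ) γ δ) := by
  intro r
  have hs := sw_strip h1 h2
  have e1 := sw_S hs.2 h3 r
  have e2 := sw_S h1 h2 r
  have b0 := hb r
  have b1 := hb (r+1)
  have e3 : S γ r + S α r ≤ S (sw α β γ) r + S β r := by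
    cases r with
    | zero => simp [S_zero]
    | succ r => have := sw_S h1 h2 r; omega
  rw [Nat.add_assoc] at b1
  norm_num at b1
  omega

lemma ballot_cross {X Y Z Z' : ℕ → ℕ} (h1 : Strip X Y) (h2 : Strip Y Z) (h3 : Strip Z Z')
    (hb : Ballot X Y Z) :
    Ballot (sw X Y (sw Y Z Z')) (sw Y Z Z') Z' := by
  intro r
  have hs := sw_strip h2 h3
  have e2 := sw_S h2 h3 r
  have b0 := hb r
  cases r with
  | zero => simp only [S_zero] at *; omega
  | succ r =>
    have e1 := sw_S h1 hs.1 r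
    have e3 := sw_S h2 h3 r
    have b1 := hb r
    norm_num [Nat.add_assoc] at *
    omega

/-- pushing a chain down along a strip -/
def push (a : ℕ → ℕ) (d : ℕ → ℕ → ℕ) : ℕ → ℕ → ℕ
  | 0 => a
  | (k+1) => sw (push a d k) (d k) (d (k+1))

lemma push_strip {a : ℕ → ℕ} {d : ℕ → ℕ → ℕ} (h0 : Strip a (d 0))
    (hd : ∀ k, Strip (d k) (d (k+1))) (k : ℕ) : Strip (push a d k) (d k) := by
  induction k with
  | zero => exact h0
  | succ k ih => exact (sw_strip ih (hd k)).2

lemma push_chain {a : ℕ → ℕ} {d : ℕ → ℕ → ℕ} (h0 : Strip a (d 0))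
    (hd : ∀ k, Strip (d k) (d (k+1))) (k : ℕ) : Strip (push a d k) (push a d (k+1)) :=
  (sw_strip (push_strip h0 hd k) (hd k)).1

lemma push_ballot {a : ℕ → ℕ} {d : ℕ → ℕ → ℕ} (h0 : Strip a (d 0))
    (hd : ∀ k, Strip (d k) (d (k+1))) (hb : ∀ k, Ballot (d k) (d (k+1)) (d (k+2))) (k : ℕ) :
    Ballot (push a d k) (push a d (k+1)) (push a d (k+2)) :=
  ballot_push (push_strip h0 hd k) (hd k) (hd (k+1)) (hb k)

lemma sw_size {a b c : ℕ → ℕ} (h1 : Strip a b) (h2 : Strip b c) {N : ℕ}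
    (hN : ∀ i, N ≤ i → c i = 0) : S (sw a b c) N + S b N = S c N + S a N := by
  have hs := sw_strip h1 h2
  have hb : ∀ i, N ≤ i → b i = 0 := fun i hi => by have := h2 i; have := hN i hi; omega
  have ha : ∀ i, N ≤ i → a i = 0 := fun i hi => by have := h1 i; have := hb i hi; omega
  have hw : ∀ i, N ≤ i → sw a b c i = 0 := fun i hi => by have := hs.2 i; have := hN i hi; omega
  have e := sw_S h1 h2 N
  rw [S_stable hN (N+2) (by omega), S_stable hN (N+1) (by omega), S_stable hb (N+1) (by omega),
    S_stable ha (N+1) (by omega), S_stable hw (N+1) (by omega)] at e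
  omega

/-- chain form of a LR tableau -/
def LRChain (lam mu nu : ℕ → ℕ) (c : ℕ → ℕ → ℕ) : Prop :=
  c 0 = lam ∧ (∃ m, ∀ k, m ≤ k → c k = nu) ∧ (∀ k, Strip (c k) (c (k+1))) ∧
  (∀ k, Ballot (c k) (c (k+1)) (c (k+2))) ∧
  ∃ N, (∀ i, N ≤ i → nu i = 0) ∧ ∀ k, S (c (k+1)) N = S (c k) N + mu k

def kap (lam : ℕ → ℕ) (i : ℕ) : ℕ → ℕ := fun k => if k < i then lam k else 0

lemma S_kap (lam : ℕ → ℕ) (i r : ℕ) : S (kap lam i) r = S lam (min i r) := by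
  induction r with
  | zero => simp [S_zero]
  | succ r ih =>
    rw [S_succ, ih, kap]
    split_ifs with h
    · rw [min_eq_right (by omega), min_eq_right (by omega), S_succ]
    · rw [min_eq_left (by omega), min_eq_left (by omega)]; rfl

lemma kap_strip {lam : ℕ → ℕ} (h : IsPartition lam) (i : ℕ) : Strip (kap lam i) (kap lam (i+1)) := by
  intro k
  have := h.1 k (k+1) (by omega)
  simp only [kap]
  constructor <;> split_ifs <;> omega

lemma kap_ballot {lam : ℕ → ℕ} (h : IsPartition lam) (i : ℕ) :
    Ballot (kap lam i) (kap lam (i+1)) (kap lam (i+2)) := by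
  intro r
  simp only [S_kap]
  rcases lt_trichotomy r i with h1 | h1 | h1
  · rw [min_eq_right (by omega), min_eq_right (by omega), min_eq_right (by omega), min_eq_right (by omega)]
  · subst h1
    rw [min_eq_right (by omega), min_eq_right (by omega), min_eq_right (by omega), min_eq_right (by omega)]
  · rw [min_eq_left (by omega), min_eq_left (by omega), min_eq_left (by omega)]
    have := h.1 i (i+1) (by omega)
    rcases Nat.lt_or_ge r (i+1) with h2 | h2
    · omega
    · rw [min_eq_left (by omega)]
      rw [show i + 2 = (i+1)+1 from rfl, S_succ lam (i+1), S_succ lam i]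
      omega

/-- a ballot chain starting at the empty partition is superstandard -/
lemma superstd {d : ℕ → ℕ → ℕ} {mu : ℕ → ℕ} {N : ℕ} (h0 : ∀ i, d 0 i = 0)
    (hs : ∀ k, Strip (d k) (d (k+1))) (hb : ∀ k, Ballot (d k) (d (k+1)) (d (k+2)))
    (hN : ∀ k i, N ≤ i → d k i = 0) (hm : ∀ k, S (d (k+1)) N = S (d k) N + mu k) (m : ℕ) :
    d m = kap mu m := by
  have hz : ∀ k i, k ≤ i → d k i = 0 := by
    intro k
    induction k with
    | zero => intro i _; exact h0 i
    | succ k ih =>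
      intro i hi
      obtain ⟨i, rfl⟩ : ∃ j, i = j+1 := ⟨i-1, by omega⟩
      have := (hs k i).2
      have := ih i (by omega)
      omega
  have hag : ∀ j, ∀ i, i < j → d (j+1) i = d j i := by
    have hp : ∀ j, S (d (j+1)) j = S (d j) j := by
      intro j
      induction j with
      | zero => simp [S_zero]
      | succ j ih =>
        have := hb j j
        have := S_mono (fun i => (hs (j+1) i).1) (j+1)
        change S (d (j+2)) (j+1) = _
        have : S (d (j+1)) (j+1) ≤ S (d (j+2)) (j+1) := this
        omega
    intro j i hi
    have h := hp j
    unfold S at h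
    have := (Finset.sum_eq_sum_iff_of_le (fun i _ => (hs j i).1)).1 h.symm i (Finset.mem_range.2 hi)
    exact this.symm
  have hst : ∀ k, S (d k) N = S (d k) k := by
    intro k
    rcases le_total N k with h | h
    · exact (S_stable (hN k) k h).symm
    · exact S_stable (hz k) N h
  have hdiag : ∀ k, d (k+1) k = mu k := by
    intro k
    have h1 := hm k
    rw [hst, hst, S_succ] at h1
    have : S (d (k+1)) k = S (d k) k :=
      Finset.sum_congr rfl fun i hi => hag k i (Finset.mem_range.1 hi)
    omega
  induction m with
  | zero => funext i; simp [kap, h0]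
  | succ m ih =>
    funext i
    rcases lt_trichotomy i m with h | h | h
    · rw [hag m i h, ih]; simp [kap, h, Nat.lt_succ_of_lt h]
    · subst h; rw [hdiag]; simp [kap]
    · rw [hz (m+1) i h]; simp only [kap]; rw [if_neg (by omega)]

def G (lam : ℕ → ℕ) (c : ℕ → ℕ → ℕ) (l : ℕ) : ℕ → ℕ → ℕ → ℕ
  | 0 => c
  | (t+1) => push (kap lam (l - (t+1))) (G lam c l t)

lemma chain_symm {lam mu nu : ℕ → ℕ} (hl : IsPartition lam) (hmu : IsPartition mu)
    {c : ℕ → ℕ → ℕ} (h : LRChain lam mu nu c) : ∃ c', LRChain mu lam nu c' := by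
  obtain ⟨hc0, ⟨m0, hm0⟩, hst, hbal, N, hN, hsz⟩ := h
  obtain ⟨l, hl0⟩ := hl.2
  obtain ⟨m1, hm1⟩ := hmu.2
  set m := max m0 m1 with hmdef
  have hkl : kap lam l = lam := by
    funext i; simp only [kap]; split_ifs with h
    · rfl
    · rw [hl0 i (by omega)]
  have hG0 : ∀ t, t ≤ l → G lam c l t 0 = kap lam (l - t) := by
    intro t ht
    cases t with
    | zero => simp [G, hc0, hkl]
    | succ t => simp [G, push]
  have hGst : ∀ t, t ≤ l → ∀ k, Strip (G lam c l t k) (G lam c l t (k+1)) := by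
    intro t
    induction t with
    | zero => intro _; exact hst
    | succ t ih =>
      intro ht
      refine push_chain ?_ (ih (by omega))
      rw [hG0 t (by omega), show l - t = l - (t+1) + 1 by omega]
      exact kap_strip hl _
  have hini : ∀ t, t + 1 ≤ l → Strip (kap lam (l - (t+1))) (G lam c l t 0) := by
    intro t ht
    rw [hG0 t (by omega), show l - t = l - (t+1) + 1 by omega]
    exact kap_strip hl _
  have hGv : ∀ t, t + 1 ≤ l → ∀ k, Strip (G lam c l (t+1) k) (G lam c l t k) := by
    intro t ht
    exact push_strip (hini t ht) (hGst t (by omega))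
  have hGb : ∀ t, t ≤ l → ∀ k, Ballot (G lam c l t k) (G lam c l t (k+1)) (G lam c l t (k+2)) := by
    intro t
    induction t with
    | zero => intro _; exact hbal
    | succ t ih =>
      intro ht
      exact push_ballot (hini t ht) (hGst t (by omega)) (ih (by omega))
  have hGvb : ∀ t, t + 2 ≤ l → ∀ k,
      Ballot (G lam c l (t+2) k) (G lam c l (t+1) k) (G lam c l t k) := by
    intro t ht k
    induction k with
    | zero =>
      rw [hG0 _ ht, hG0 _ (by omega), hG0 _ (by omega)]
      have := kap_ballot hl (l - (t+2))
      rwa [show l - (t+2) + 1 = l - (t+1) by omega, show l - (t+2) + 2 = l - t by omega] at this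
    | succ k ih =>
      exact ballot_cross (hGv (t+1) ht k) (hGv t (by omega) k) (hGst t (by omega) k) ih
  have hcN : ∀ k i, N ≤ i → c k i = 0 := by
    intro k i hi
    have h1 : ∀ s, c k i ≤ c (k+s) i := by
      intro s
      induction s with
      | zero => exact le_rfl
      | succ s ih => exact ih.trans (hst (k+s) i).1
    have := h1 m0
    rw [hm0 (k+m0) (by omega), hN i hi] at this
    omega
  have hGN : ∀ t, t ≤ l → ∀ k i, N ≤ i → G lam c l t k i = 0 := by
    intro t
    induction t with
    | zero => intro _; exact hcN
    | succ t ih =>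
      intro ht k i hi
      have := (hGv t ht k i).1
      have := ih (by omega) k i hi
      omega
  have hGsz : ∀ t, t ≤ l → ∀ k, S (G lam c l t (k+1)) N = S (G lam c l t k) N + mu k := by
    intro t
    induction t with
    | zero => intro _; exact hsz
    | succ t ih =>
      intro ht k
      have := sw_size (hGv t ht k) (hGst t (by omega) k) (hGN t (by omega) (k+1))
      have h2 := ih (by omega) k
      change S (sw (G lam c l (t+1) k) (G lam c l t k) (G lam c l t (k+1))) N = _
      omega
  have hGsv : ∀ t, t + 1 ≤ l → ∀ k, S (G lam c l t k) N = S (G lam c l (t+1) k) N + lam (l-(t+1)) := by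
    intro t ht k
    induction k with
    | zero =>
      rw [hG0 t (by omega), hG0 _ ht, S_kap, S_kap]
      have hlN : ∀ i, N ≤ i → lam i = 0 := by rw [← hc0]; exact hcN 0
      obtain ⟨i, hi⟩ : ∃ i, i = l - (t+1) := ⟨_, rfl⟩
      rw [← hi, show l - t = i + 1 by omega]
      rcases Nat.lt_or_ge i N with h | h
      · rw [min_eq_left (by omega), min_eq_left (by omega), S_succ]
      · rw [min_eq_right (by omega), min_eq_right (by omega), hlN i h]; rfl
    | succ k ih =>
      have h1 := hGsz t (by omega) k
      have h2 := hGsz (t+1) ht k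
      omega
  refine ⟨fun i => G lam c l (l - i) m, ?_, ⟨l, ?_⟩, ?_, ?_, N, hN, ?_⟩
  · have := superstd (d := G lam c l l) (mu := mu) (N := N)
      (by intro i; rw [hG0 l le_rfl]; simp [kap]) (hGst l le_rfl) (hGb l le_rfl) (hGN l le_rfl)
      (hGsz l le_rfl) m
    simp only [Nat.sub_zero]
    rw [this]
    funext i; simp only [kap]; split_ifs with h
    · rfl
    · rw [hm1 i (by omega)]
  · intro k hk
    simp only [Nat.sub_eq_zero_of_le hk, G]
    exact hm0 m (by omega)
  · intro k
    rcases Nat.lt_or_ge k l with h | h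
    · have := hGv (l - (k+1)) (by omega) m
      rwa [show l - (k+1) + 1 = l - k by omega] at this
    · simp only [Nat.sub_eq_zero_of_le h, Nat.sub_eq_zero_of_le (show l ≤ k+1 by omega), G]
      intro i
      have h1 := hst m i
      rw [hm0 (m+1) (by omega), hm0 m (by omega)] at h1
      rw [hm0 m (by omega)]
      omega
  · intro k
    rcases Nat.lt_or_ge (k+1) l with h | h
    · have := hGvb (l - (k+2)) (by omega) m
      rwa [show l - (k+2) + 1 = l - (k+1) by omega, show l - (k+2) + 2 = l - k by omega] at this
    · simp only [Nat.sub_eq_zero_of_le h, Nat.sub_eq_zero_of_le (show l ≤ k+2 by omega)]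
      intro r
      have : S (G lam c l (l-k) m) r ≤ S (G lam c l 0 m) r := by
        rcases Nat.lt_or_ge k l with h' | h'
        · rw [show l - k = 0 + 1 by omega]
          exact S_mono (fun i => (hGv 0 (by omega) m i).1) r
        · rw [Nat.sub_eq_zero_of_le h']
      omega
  · intro k
    rcases Nat.lt_or_ge k l with h | h
    · have := hGsv (l - (k+1)) (by omega) m
      rwa [show l - (k+1) + 1 = l - k by omega, show l - (l - k) = k by omega] at this
    · simp only [Nat.sub_eq_zero_of_le h, Nat.sub_eq_zero_of_le (show l ≤ k+1 by omega), hl0 k h]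
      rfl

def region (f g : ℕ → ℕ) : Set (ℕ × ℕ) := {p | f p.1 ≤ p.2 ∧ p.2 < g p.1}

lemma region_lt (f g : ℕ → ℕ) (N : ℕ) :
    ({p ∈ region f g | p.1 < N}).Finite ∧
    ({p ∈ region f g | p.1 < N}).ncard = ∑ i ∈ Finset.range N, (g i - f i) := by
  have : {p ∈ region f g | p.1 < N} =
      (((Finset.range N).sigma (fun i => Finset.Ico (f i) (g i))).map
        (Equiv.sigmaEquivProd ℕ ℕ).toEmbedding : Finset (ℕ × ℕ)) := by
    ext ⟨i, j⟩
    simp [region]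
    tauto
  rw [this]
  refine ⟨Finset.finite_toSet _, ?_⟩
  rw [Set.ncard_coe_finset, Finset.card_map, Finset.card_sigma]
  simp

lemma S_sub {f g : ℕ → ℕ} (h : ∀ i, f i ≤ g i) (N : ℕ) :
    ∑ i ∈ Finset.range N, (g i - f i) + S f N = S g N := by
  unfold S
  rw [← Finset.sum_add_distrib]
  exact Finset.sum_congr rfl fun i _ => by have := h i; omega

/-- compatibility of a filling with a chain -/
structure Compat (lam nu : ℕ → ℕ) (T c : ℕ → ℕ → ℕ) : Prop where
  lo : ∀ k i, lam i ≤ c k i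
  hi : ∀ k i, c k i ≤ nu i
  iff : ∀ k i j, InSkew lam nu i j → (T i j ≤ k ↔ j < c k i)

lemma Compat.set_eq {lam nu : ℕ → ℕ} {T c : ℕ → ℕ → ℕ} (h : Compat lam nu T c) (k : ℕ) :
    ∀ p : ℕ × ℕ, (InSkew lam nu p.1 p.2 ∧ T p.1 p.2 = k + 1) ↔ p ∈ region (c k) (c (k+1)) := by
  rintro ⟨i, j⟩
  simp only [region, Set.mem_ofPred_eq]
  constructor
  · rintro ⟨h1, h2⟩
    have e1 := h.iff k i j h1
    have e2 := h.iff (k+1) i j h1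
    omega
  · rintro ⟨h1, h2⟩
    have hs : InSkew lam nu i j := ⟨(h.lo k i).trans h1, h2.trans_le (h.hi _ i)⟩
    have e1 := h.iff k i j hs
    have e2 := h.iff (k+1) i j hs
    exact ⟨hs, by omega⟩

lemma Compat.ncard {lam nu : ℕ → ℕ} {T c : ℕ → ℕ → ℕ} (h : Compat lam nu T c) (k : ℕ)
    {N : ℕ} (hN : ∀ i, N ≤ i → nu i = 0) (hm : ∀ i, c k i ≤ c (k+1) i) :
    {p : ℕ × ℕ | InSkew lam nu p.1 p.2 ∧ T p.1 p.2 = k + 1}.ncard + S (c k) N = S (c (k+1)) N := by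
  have : {p : ℕ × ℕ | InSkew lam nu p.1 p.2 ∧ T p.1 p.2 = k + 1} =
      {p ∈ region (c k) (c (k+1)) | p.1 < N} := by
    ext p
    rw [Set.mem_ofPred_eq, h.set_eq k p]
    constructor
    · intro hp
      refine ⟨hp, ?_⟩
      by_contra hc
      have h1 := hp.2
      have := h.hi (k+1) p.1
      have := hN p.1 (by omega)
      omega
    · exact fun hp => hp.1
  rw [this, (region_lt _ _ N).2, S_sub hm]

lemma chain_mono {c : ℕ → ℕ → ℕ} (h : ∀ k, Strip (c k) (c (k+1))) (i : ℕ) :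
    Monotone (fun k => c k i) := monotone_nat_of_le_succ fun k => (h k i).1

lemma tab_to_chain {lam mu nu : ℕ → ℕ} {T : ℕ → ℕ → ℕ} (hT : IsLRTableau lam mu nu T) :
    ∃ c, LRChain lam mu nu c := by
  obtain ⟨hl, hmu, hnu, hle, hoff, hon, hrow, hcol, hcont, hbal⟩ := hT
  let c : ℕ → ℕ → ℕ := fun k i => lam i + ((Finset.Ico (lam i) (nu i)).filter (fun j => T i j ≤ k)).card
  have hC : Compat lam nu T c := by
    refine ⟨fun k i => Nat.le_add_right _ _, fun k i => ?_, ?_⟩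
    · have := Finset.card_filter_le (Finset.Ico (lam i) (nu i)) (fun j => T i j ≤ k)
      rw [Nat.card_Ico] at this
      have := hle i
      simp only [c]
      omega
    · intro k i j hj
      constructor
      · intro h
        have : Finset.Ico (lam i) (j+1) ⊆ (Finset.Ico (lam i) (nu i)).filter (fun j => T i j ≤ k) := by
          intro x hx
          rw [Finset.mem_Ico] at hx
          have h1 := hj.1
          have h2 := hj.2
          rw [Finset.mem_filter, Finset.mem_Ico]
          have hxs : InSkew lam nu i x := ⟨hx.1, by omega⟩
          exact ⟨hxs, (hrow i x j hxs hj (by omega)).trans h⟩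
        have := Finset.card_le_card this
        rw [Nat.card_Ico] at this
        have := hj.1
        simp only [c]
        omega
      · intro h
        by_contra hk
        have : (Finset.Ico (lam i) (nu i)).filter (fun j => T i j ≤ k) ⊆ Finset.Ico (lam i) j := by
          intro x hx
          rw [Finset.mem_filter, Finset.mem_Ico] at hx
          rw [Finset.mem_Ico]
          refine ⟨hx.1.1, ?_⟩
          by_contra hxj
          have := hrow i j x hj hx.1 (by omega)
          omega
        have := Finset.card_le_card this
        rw [Nat.card_Ico] at this
        have := hj.1
        simp only [c] at h
        omega
  have hmono : ∀ k i, c k i ≤ c (k+1) i := by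
    intro k i
    simp only [c]
    gcongr with j hj
    omega
  have hstrip : ∀ k, Strip (c k) (c (k+1)) := by
    intro k i
    refine ⟨hmono k i, ?_⟩
    by_contra hlt
    have a1 := hC.lo k i
    have a2 := hC.hi (k+1) (i+1)
    have a3 := hl.1 i (i+1) (by omega)
    have a4 := hnu.1 i (i+1) (by omega)
    have s1 : InSkew lam nu i (c k i) := ⟨by omega, by omega⟩
    have s2 : InSkew lam nu (i+1) (c k i) := ⟨by omega, by omega⟩
    have b1 := hC.iff k i _ s1
    have b2 := hC.iff (k+1) (i+1) _ s2
    have b3 := hcol i (i+1) _ s1 s2 (by omega)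
    omega
  obtain ⟨N, hN⟩ := hnu.2
  obtain ⟨M, hM⟩ := hmu.2
  have hsz : ∀ k, S (c (k+1)) N = S (c k) N + mu k := by
    intro k
    have := hC.ncard k hN (hmono k)
    rw [hcont k] at this
    omega
  have h0 : c 0 = lam := by
    funext i
    simp only [c]
    rw [Finset.filter_false_of_mem]
    · simp
    · intro j hj
      rw [Finset.mem_Ico] at hj
      have := hon i j hj
      omega
  refine ⟨c, h0, ⟨M, ?_⟩, hstrip, ?_, N, hN, hsz⟩
  · intro k hk
    funext i
    refine le_antisymm (hC.hi k i) ?_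
    by_contra hlt
    have s1 : InSkew lam nu i (c k i) := ⟨hC.lo k i, by omega⟩
    have b1 := hC.iff k i _ s1
    have hk' : k < T i (c k i) := by omega
    obtain ⟨t, ht⟩ : ∃ t, T i (c k i) = t + 1 := ⟨T i (c k i) - 1, by omega⟩
    have hmem := (hC.set_eq t (i, c k i)).1 ⟨s1, ht⟩
    have h1 : S (c (t+1)) N = S (c t) N := by rw [hsz, hM t (by omega)]; rfl
    have hiN : i < N := by
      by_contra hc
      have := hN i (by omega)
      omega
    have := (Finset.sum_eq_sum_iff_of_le (fun i _ => hmono t i)).1 h1.symm i (Finset.mem_range.2 hiN)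
    have h2 := hmem.1
    have h3 := hmem.2
    simp only at h2 h3
    omega
  · intro k
    -- ballot
    have key : ∀ r, ∑ i ∈ Finset.range (r+1), (c (k+2) i - c (k+1) i) ≤
        ∑ i ∈ Finset.range r, (c (k+1) i - c k i) := by
      intro r
      induction r using Nat.strong_induction_on with
      | _ r ih =>
      by_cases hr : c (k+1) r < c (k+2) r
      · have hmem : (r, c (k+1) r) ∈ region (c (k+1)) (c (k+2)) := ⟨le_rfl, hr⟩
        obtain ⟨hq1, hq2⟩ := (hC.set_eq (k+1) _).2 hmem
        have := hbal k _ hq1 hq2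
        rw [← (region_lt _ _ _).2, ← (region_lt _ _ _).2]
        refine le_trans (le_trans ?_ this) ?_
        · apply le_of_eq
          congr 1
          ext p
          have e := hC.set_eq (k+1) p
          simp only [Set.mem_ofPred_eq, ← and_assoc]
          rw [e]
          refine and_congr_right fun hp => ?_
          have := hp.1
          constructor
          · intro h
            rcases Nat.lt_or_ge p.1 r with h' | h'
            · exact Or.inl h'
            · have : p.1 = r := by omega
              refine Or.inr ⟨this, ?_⟩
              rw [← this]
              exact hp.1
          · rintro (h | h)
            · simp only at h; omega
            · have := h.1; simp only at this; omega
        · refine Set.ncard_le_ncard ?_ (region_lt _ _ _).1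
          intro p hp
          simp only [Set.mem_ofPred_eq, ← and_assoc] at hp
          rw [hC.set_eq k p] at hp
          refine ⟨hp.1, ?_⟩
          rcases hp.2 with h | h
          · exact h
          · exfalso
            have h1 := hp.1.2
            have h2 := h.1
            have h3 := h.2
            simp only at h2 h3
            rw [h2] at h1
            omega
      · rw [Finset.sum_range_succ]
        have e0 : c (k+2) r - c (k+1) r = 0 := by omega
        rw [e0, add_zero]
        cases r with
        | zero => simp
        | succ r =>
          refine (ih r (by omega)).trans ?_
          rw [Finset.sum_range_succ]
          omega
    intro r
    have h1 := S_sub (hmono (k+1)) (r+1)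
    have h2 := S_sub (hmono k) r
    have h3 := key r
    simp only [Nat.add_assoc, Nat.reduceAdd] at *
    omega

lemma chain_to_tab {lam mu nu : ℕ → ℕ} (hl : IsPartition lam) (hmu : IsPartition mu)
    (hnu : IsPartition nu) {c : ℕ → ℕ → ℕ} (h : LRChain lam mu nu c) :
    ∃ T, IsLRTableau lam mu nu T := by
  classical
  obtain ⟨hc0, ⟨m, hm⟩, hst, hbal, N, hN, hsz⟩ := h
  let T : ℕ → ℕ → ℕ := fun i j => if InSkew lam nu i j then sInf {k | j < c k i} else 0
  have hmono := chain_mono hst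
  have hC : Compat lam nu T c := by
    refine ⟨fun k i => ?_, fun k i => ?_, ?_⟩
    · rw [← hc0]; exact hmono i (Nat.zero_le k)
    · rw [← hm (max m k) (by omega)]; exact hmono i (by omega)
    · intro k i j hj
      have hne : {k | j < c k i}.Nonempty := ⟨m, by
        change j < c m i
        rw [hm m le_rfl]; exact hj.2⟩
      simp only [T, if_pos hj]
      constructor
      · intro hk
        have h1 : j < c (sInf {k | j < c k i}) i := Nat.sInf_mem hne
        exact h1.trans_le (hmono i hk)
      · intro hk
        exact Nat.sInf_le hk
  have hle : ∀ i, lam i ≤ nu i := fun i => (hC.lo 0 i).trans (hC.hi 0 i)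
  have hS : ∀ k i, c k i ≤ c (k+1) i := fun k i => (hst k i).1
  refine ⟨T, hl, hmu, hnu, hle, ?_, ?_, ?_, ?_, ?_, ?_⟩
  · intro i j hij; simp only [T, if_neg hij]
  · intro i j hij
    have := hC.iff 0 i j hij
    rw [hc0] at this
    have := hij.1
    omega
  · intro i j j' h1 h2 hjj
    rw [hC.iff _ i j h1]
    have := (hC.iff (T i j') i j' h2).1 le_rfl
    omega
  · have step : ∀ i j, InSkew lam nu i j → InSkew lam nu (i+1) j → T i j < T (i+1) j := by
      intro i j h1 h2
      have h3 := hC.iff 0 (i+1) j h2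
      rw [hc0] at h3
      have := h2.1
      obtain ⟨t, ht⟩ : ∃ t, T (i+1) j = t + 1 := ⟨T (i+1) j - 1, by omega⟩
      have h4 := hC.iff (t+1) (i+1) j h2
      have h5 := hC.iff t i j h1
      have := (hst t i).2
      omega
    intro i i' j h1 h2 hii
    induction i', hii using Nat.le_induction with
    | base => exact step i j h1 h2
    | succ i' hi ih =>
      have h3 : InSkew lam nu i' j := by
        have := hl.1 i i' (by omega)
        have := hnu.1 i' (i'+1) (by omega)
        have := h1.1
        have := h2.2
        exact ⟨by omega, by omega⟩
      exact (ih h3).trans (step i' j h3 h2)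
  · intro k
    have := hC.ncard k hN (hS k)
    have := hsz k
    omega
  · intro k q hq hTq
    have h1 := S_sub (hS (k+1)) (q.1+1)
    have h2 := S_sub (hS k) q.1
    have h3 := hbal k q.1
    have h4 : ∑ i ∈ Finset.range (q.1+1), (c (k+2) i - c (k+1) i) ≤
        ∑ i ∈ Finset.range q.1, (c (k+1) i - c k i) := by
      simp only [Nat.add_assoc, Nat.reduceAdd] at *
      omega
    rw [← (region_lt _ _ _).2, ← (region_lt _ _ _).2] at h4
    refine le_trans (Set.ncard_le_ncard ?_ (region_lt _ _ _).1) (h4.trans (Set.ncard_le_ncard ?_ ?_))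
    · intro p hp
      simp only [Set.mem_ofPred_eq, ← and_assoc] at hp
      rw [hC.set_eq (k+1) p] at hp
      refine ⟨hp.1, ?_⟩
      rcases hp.2 with h | h
      · omega
      · omega
    · intro p hp
      simp only [Set.mem_ofPred_eq, ← and_assoc]
      rw [hC.set_eq k p]
      exact ⟨hp.1, Or.inl hp.2⟩
    · refine (region_lt (c k) (c (k+1)) (q.1+1)).1.subset ?_
      intro p hp
      simp only [Set.mem_ofPred_eq, ← and_assoc] at hp
      rw [hC.set_eq k p] at hp
      refine ⟨hp.1, ?_⟩
      rcases hp.2 with h | h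
      · omega
      · omega

lemma tab_symm {lam mu nu : ℕ → ℕ} (h : ∃ T, IsLRTableau lam mu nu T) :
    ∃ T, IsLRTableau mu lam nu T := by
  obtain ⟨T, hT⟩ := h
  obtain ⟨c, hc⟩ := tab_to_chain hT
  obtain ⟨c', hc'⟩ := chain_symm hT.1 hT.2.1 hc
  exact chain_to_tab hT.2.1 hT.1 hT.2.2.1 hc'

lemma tab_finite (lam mu nu : ℕ → ℕ) : Finite {T : ℕ → ℕ → ℕ // IsLRTableau lam mu nu T} := by
  by_cases hne : ∃ T, IsLRTableau lam mu nu T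
  swap
  · have : IsEmpty {T : ℕ → ℕ → ℕ // IsLRTableau lam mu nu T} := ⟨fun T => hne ⟨_, T.2⟩⟩
    infer_instance
  obtain ⟨T0, hT0⟩ := hne
  obtain ⟨N, hN⟩ := hT0.2.2.1.2
  obtain ⟨M, hM⟩ := hT0.2.1.2
  have hnu := hT0.2.2.1
  have bound : ∀ T, IsLRTableau lam mu nu T → ∀ i j, T i j < M + 1 := by
    intro T hT i j
    obtain ⟨-, -, -, -, hoff, hon, -, -, hcont, -⟩ := hT
    by_contra hc
    have hs : InSkew lam nu i j := by
      by_contra h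
      have := hoff i j h
      omega
    obtain ⟨t, ht⟩ : ∃ t, T i j = t + 1 := ⟨T i j - 1, by omega⟩
    have h1 := hcont t
    have hfin : {p : ℕ × ℕ | InSkew lam nu p.1 p.2 ∧ T p.1 p.2 = t + 1}.Finite := by
      refine (region_lt lam nu N).1.subset ?_
      rintro p ⟨hp, -⟩
      refine ⟨hp, ?_⟩
      by_contra hcc
      have := hN p.1 (by omega)
      have := hp.2
      omega
    rw [hM t (by omega), Set.ncard_eq_zero hfin] at h1
    have : (i, j) ∈ {p : ℕ × ℕ | InSkew lam nu p.1 p.2 ∧ T p.1 p.2 = t + 1} := ⟨hs, ht⟩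
    rw [h1] at this
    exact this
  let F : {T : ℕ → ℕ → ℕ // IsLRTableau lam mu nu T} → (Fin N → Fin (nu 0) → Fin (M+1)) :=
    fun T i j => ⟨T.1 i j, bound T.1 T.2 i j⟩
  refine Finite.of_injective F ?_
  intro T T' hTT
  apply Subtype.ext
  funext i j
  by_cases hs : InSkew lam nu i j
  · have h1 : i < N := by
      by_contra hcc
      have := hN i (by omega)
      have := hs.2
      omega
    have h2 : j < nu 0 := hs.2.trans_le (hnu.1 0 i (Nat.zero_le i))
    have := congrFun (congrFun hTT ⟨i, h1⟩) ⟨j, h2⟩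
    exact congrArg Fin.val this
  · rw [T.2.2.2.2.2.1 i j hs, T'.2.2.2.2.2.1 i j hs]

lemma lr_ne_zero {lam mu nu : ℕ → ℕ} : lrCoeff lam mu nu ≠ 0 ↔ ∃ T, IsLRTableau lam mu nu T := by
  have := tab_finite lam mu nu
  unfold lrCoeff
  rw [Nat.card_ne_zero]
  constructor
  · rintro ⟨⟨T⟩, -⟩; exact ⟨_, T.2⟩
  · rintro ⟨T, hT⟩; exact ⟨⟨⟨T, hT⟩⟩, this⟩

lemma lr_symm {lam mu nu : ℕ → ℕ} (h : lrCoeff lam mu nu ≠ 0) : lrCoeff mu lam nu ≠ 0 :=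
  lr_ne_zero.2 (tab_symm (lr_ne_zero.1 h))

lemma lr_le {lam mu nu : ℕ → ℕ} (h : lrCoeff lam mu nu ≠ 0) :
    IsPartition lam ∧ IsPartition nu ∧ lam ≤ nu := by
  obtain ⟨T, hT⟩ := lr_ne_zero.1 h
  exact ⟨hT.1, hT.2.2.1, hT.2.2.2.1⟩

lemma finite_below {l : ℕ → ℕ} (hl : IsPartition l) : {f : ℕ → ℕ | f ≤ l}.Finite := by
  obtain ⟨N, hN⟩ := hl.2
  let F : {f : ℕ → ℕ | f ≤ l} → (Fin N → Fin (l 0 + 1)) := fun f i =>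
    ⟨f.1 i, Nat.lt_succ_of_le ((f.2 i).trans (hl.1 0 i (Nat.zero_le _)))⟩
  have : Function.Injective F := by
    intro f g hfg
    apply Subtype.ext
    funext i
    by_cases h : i < N
    · exact congrArg Fin.val (congrFun hfg ⟨i, h⟩)
    · have h1 : f.1 i ≤ l i := f.2 i
      have h2 : g.1 i ≤ l i := g.2 i
      have := hN i (by omega)
      omega
  exact Set.finite_coe_iff.1 (Finite.of_injective F this)

lemma finsum_ne {l : ℕ → ℕ} (hl : IsPartition l) {F : (ℕ → ℕ) → ℕ} (hF : ∀ a, F a ≠ 0 → a ≤ l)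
    (a : ℕ → ℕ) (ha : F a ≠ 0) : ∑ᶠ a, F a ≠ 0 := by
  have hfin : (Function.support F).Finite := (finite_below hl).subset fun a ha => hF a ha
  have := single_le_finsum a hfin (fun _ => Nat.zero_le _)
  omega

lemma ex_of_finsum {F : (ℕ → ℕ) → ℕ} (h : ∑ᶠ a, F a ≠ 0) : ∃ a, F a ≠ 0 := by
  by_contra hc
  push Not at hc
  exact h (by simp [hc])

lemma NL6_ne_zero {l1 l2 l3 l4 l5 l6 : ℕ → ℕ} : NL6 l1 l2 l3 l4 l5 l6 ≠ 0 ↔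
    ∃ a1 a2 a3 a4 a5 a6, lrCoeff a1 a2 l1 ≠ 0 ∧ lrCoeff a2 a3 l2 ≠ 0 ∧ lrCoeff a3 a4 l3 ≠ 0 ∧
      lrCoeff a4 a5 l4 ≠ 0 ∧ lrCoeff a5 a6 l5 ≠ 0 ∧ lrCoeff a6 a1 l6 ≠ 0 := by
  unfold NL6
  constructor
  · intro h
    obtain ⟨a1, h⟩ := ex_of_finsum h
    obtain ⟨a2, h⟩ := ex_of_finsum h
    obtain ⟨a3, h⟩ := ex_of_finsum h
    obtain ⟨a4, h⟩ := ex_of_finsum h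
    obtain ⟨a5, h⟩ := ex_of_finsum h
    obtain ⟨a6, h⟩ := ex_of_finsum h
    simp only [mul_ne_zero_iff] at h
    exact ⟨a1, a2, a3, a4, a5, a6, by tauto⟩
  · rintro ⟨a1, a2, a3, a4, a5, a6, h1, h2, h3, h4, h5, h6⟩
    refine finsum_ne (lr_le h1).2.1 ?_ a1 (finsum_ne (lr_le h2).2.1 ?_ a2
      (finsum_ne (lr_le h3).2.1 ?_ a3 (finsum_ne (lr_le h4).2.1 ?_ a4
      (finsum_ne (lr_le h5).2.1 ?_ a5 (finsum_ne (lr_le h6).2.1 ?_ a6 ?_)))))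
    · intro a h
      obtain ⟨a2, h⟩ := ex_of_finsum h
      obtain ⟨a3, h⟩ := ex_of_finsum h
      obtain ⟨a4, h⟩ := ex_of_finsum h
      obtain ⟨a5, h⟩ := ex_of_finsum h
      obtain ⟨a6, h⟩ := ex_of_finsum h
      simp only [mul_ne_zero_iff] at h
      exact (lr_le h.1.1.1.1.1).2.2
    · intro a h
      obtain ⟨a3, h⟩ := ex_of_finsum h
      obtain ⟨a4, h⟩ := ex_of_finsum h
      obtain ⟨a5, h⟩ := ex_of_finsum h
      obtain ⟨a6, h⟩ := ex_of_finsum h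
      simp only [mul_ne_zero_iff] at h
      exact (lr_le h.1.1.1.1.2).2.2
    · intro a h
      obtain ⟨a4, h⟩ := ex_of_finsum h
      obtain ⟨a5, h⟩ := ex_of_finsum h
      obtain ⟨a6, h⟩ := ex_of_finsum h
      simp only [mul_ne_zero_iff] at h
      exact (lr_le h.1.1.1.2).2.2
    · intro a h
      obtain ⟨a5, h⟩ := ex_of_finsum h
      obtain ⟨a6, h⟩ := ex_of_finsum h
      simp only [mul_ne_zero_iff] at h
      exact (lr_le h.1.1.2).2.2
    · intro a h
      obtain ⟨a6, h⟩ := ex_of_finsum h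
      simp only [mul_ne_zero_iff] at h
      exact (lr_le h.1.2).2.2
    · intro a h
      simp only [mul_ne_zero_iff] at h
      exact (lr_le h.2).2.2
    · simp only [mul_ne_zero_iff]
      tauto

lemma nthSmall_eq {A : Finset ℕ} {r : ℕ} (hr : A.card = r) (k : Fin r) :
    nthSmall A k = A.orderEmbOfFin hr k := by
  rw [Finset.orderEmbOfFin_apply]
  unfold nthSmall
  rw [List.getD_eq_getElem _ _ (by rw [Finset.length_sort, hr]; exact k.2)]
  rfl

lemma tau_surj {n : ℕ} {A' : Finset ℕ} (hA' : A' ⊆ Finset.Icc 1 n) {f : ℕ → ℕ}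
    (hf : IsPartition f) (hle : f ≤ tauP A') :
    ∃ A1 ⊆ Finset.Icc 1 n, A1.card = A'.card ∧ tauP A1 = f := by
  obtain ⟨r, hr⟩ : ∃ r, A'.card = r := ⟨_, rfl⟩
  have hrn : r ≤ n := by
    have := Finset.card_le_card hA'
    simp at this; omega
  have hz : ∀ k, r ≤ k → f k = 0 := by
    intro k hk
    have := hle k
    simp only [tauP, hr, if_neg (show ¬ k < r by omega)] at this
    omega
  have hb : ∀ k, k < r → f k + r ≤ n := by
    intro k hk
    have h1 := hle 0
    have h2 := hf.1 0 k (Nat.zero_le _)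
    simp only [tauP, hr, if_pos (show 0 < r by omega)] at h1
    have h3 := nthSmall_eq hr ⟨r - 1, by omega⟩
    have h4 := hA' (Finset.orderEmbOfFin_mem A' hr ⟨r - 1, by omega⟩)
    rw [← h3, Finset.mem_Icc] at h4
    simp only [Nat.sub_zero] at h1
    have := h4.2
    simp only at this
    omega
  let g : Fin r → ℕ := fun k => f (r - 1 - k) + k + 1
  have hg : StrictMono g := by
    intro a b hab
    have : (a : ℕ) < b := hab
    have := hf.1 (r - 1 - b) (r - 1 - a) (by omega)
    simp only [g]
    omega
  let A1 := Finset.univ.image g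
  have hc : A1.card = r := by
    rw [Finset.card_image_of_injective _ hg.injective]; simp
  refine ⟨A1, ?_, hc.trans hr.symm, ?_⟩
  · intro x hx
    obtain ⟨k, -, rfl⟩ := Finset.mem_image.1 hx
    rw [Finset.mem_Icc]
    have := k.2
    have := hb (r - 1 - k) (by omega)
    simp only [g]
    omega
  · have hu : g = A1.orderEmbOfFin hc :=
      Finset.orderEmbOfFin_unique hc (fun x => Finset.mem_image_of_mem _ (Finset.mem_univ _)) hg
    funext k
    simp only [tauP, hc]
    split_ifs with h
    · have h1 := nthSmall_eq hc ⟨r - 1 - k, by omega⟩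
      rw [← hu] at h1
      simp only [g] at h1
      rw [h1, show r - 1 - (r - 1 - k) = k by omega]
      omega
    · exact (hz k (by omega)).symm

end LRS

/-- **Lemma.** A sextuple `(A,A',B,B',C,C')` parametrizes an extended Horn
inequality (condition (III): existence of `A₁,A₂,B₁,B₂,C₁,C₂`) iff the
multiple Newell–Littlewood number `N_{τ(A'),τ(B),τ(C'),τ(A),τ(B'),τ(C)}` is
nonzero. -/
theorem stmt3 (n : ℕ) (A A' B B' C C' : Finset ℕ)
    (hA : A ⊆ Finset.Icc 1 n) (hA' : A' ⊆ Finset.Icc 1 n)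
    (hB : B ⊆ Finset.Icc 1 n) (hB' : B' ⊆ Finset.Icc 1 n)
    (hC : C ⊆ Finset.Icc 1 n) (hC' : C' ⊆ Finset.Icc 1 n)
    (dA : A ∩ A' = ∅) (dB : B ∩ B' = ∅) (dC : C ∩ C' = ∅)
    (cA : A.card = B'.card + C'.card) (cB : B.card = A'.card + C'.card)
    (cC : C.card = A'.card + B'.card) :
    (∃ A1 A2 B1 B2 C1 C2 : Finset ℕ,
      A1 ⊆ Finset.Icc 1 n ∧ A2 ⊆ Finset.Icc 1 n ∧ B1 ⊆ Finset.Icc 1 n ∧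
      B2 ⊆ Finset.Icc 1 n ∧ C1 ⊆ Finset.Icc 1 n ∧ C2 ⊆ Finset.Icc 1 n ∧
      A1.card = A'.card ∧ A2.card = A'.card ∧ B1.card = B'.card ∧
      B2.card = B'.card ∧ C1.card = C'.card ∧ C2.card = C'.card ∧
      0 < lrCoeff (tauP A1) (tauP A2) (tauP A') ∧
      0 < lrCoeff (tauP B1) (tauP B2) (tauP B') ∧
      0 < lrCoeff (tauP C1) (tauP C2) (tauP C') ∧
      0 < lrCoeff (tauP B1) (tauP C2) (tauP A) ∧
      0 < lrCoeff (tauP C1) (tauP A2) (tauP B) ∧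
      0 < lrCoeff (tauP A1) (tauP B2) (tauP C)) ↔
    NL6 (tauP A') (tauP B) (tauP C') (tauP A) (tauP B') (tauP C) ≠ 0 := by
  simp only [Nat.pos_iff_ne_zero]
  rw [LRS.NL6_ne_zero]
  constructor
  · rintro ⟨A1, A2, B1, B2, C1, C2, -, -, -, -, -, -, -, -, -, -, -, -, h1, h2, h3, h4, h5, h6⟩
    exact ⟨tauP A1, tauP A2, tauP C1, tauP C2, tauP B1, tauP B2, h1, LRS.lr_symm h5, h3,
      LRS.lr_symm h4, h2, LRS.lr_symm h6⟩
  · rintro ⟨a1, a2, c1, c2, b1, b2, h1, h5, h3, h4, h2, h6⟩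
    have k1 := LRS.lr_le h1
    have k2 := LRS.lr_le (LRS.lr_symm h1)
    have k3 := LRS.lr_le h2
    have k4 := LRS.lr_le (LRS.lr_symm h2)
    have k5 := LRS.lr_le h3
    have k6 := LRS.lr_le (LRS.lr_symm h3)
    obtain ⟨A1, sA1, cA1, rfl⟩ := LRS.tau_surj hA' k1.1 k1.2.2
    obtain ⟨A2, sA2, cA2, rfl⟩ := LRS.tau_surj hA' k2.1 k2.2.2
    obtain ⟨B1, sB1, cB1, rfl⟩ := LRS.tau_surj hB' k3.1 k3.2.2
    obtain ⟨B2, sB2, cB2, rfl⟩ := LRS.tau_surj hB' k4.1 k4.2.2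
    obtain ⟨C1, sC1, cC1, rfl⟩ := LRS.tau_surj hC' k5.1 k5.2.2
    obtain ⟨C2, sC2, cC2, rfl⟩ := LRS.tau_surj hC' k6.1 k6.2.2
    exact ⟨A1, A2, B1, B2, C1, C2, sA1, sA2, sB1, sB2, sC1, sC2, cA1, cA2, cB1, cB2, cC1, cC2,
      h1, h2, h3, LRS.lr_symm h4, LRS.lr_symm h5, LRS.lr_symm h6⟩
end

section
/- Let A,A' ⊆ [n] be disjoint, a = |A|, a' = |A'|, r = a + a', A = {α_1<…<α_a}, A' = {α'_1<…<α'_{a'}}. Set I := A' ∪ {2n+1−i : i ∈ A} ⊆ [2n] and Ī := {2n+1−i : i ∈ I}, and let χ be the word of length 2n with χ_j = 1 if j ∈ I, χ_j = 0 if j ∈ Ī, and χ_j = 2 otherwise. Deleting all 2's from χ yields the characteristic word of a subset I² ⊆ [2r], and deleting all 0's from χ and then replacing all 2's by 0's yields the characteristic word of a subset I⁰ ⊆ [2n−r]. Then the partitions τ(I²) and τ(I⁰) are given explicitly by: τ(I²)_k = a + #(A' ∩ [α_k, n]) for 1 ≤ k ≤ a; τ(I²)_{a+l} = #(A ∩ [1,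 α'_{a'+1−l}]) for 1 ≤ l ≤ a'; τ(I⁰)_k = n − a − a' + #([α_k, n] \ (A∪A')) for 1 ≤ k ≤ a; τ(I⁰)_{a+l} = #([1, α'_{a'+1−l}] \ (A∪A')) for 1 ≤ l ≤ a'. -/
theorem nthSmall_eq (S : Finset ℕ) (k : ℕ) : nthSmall S k = Nat.nth (· ∈ S) k := by
  have h : Set.Finite {x | x ∈ S} := S.finite_toSet
  have h2 : h.toFinset = S := by ext; simp
  rw [Nat.nth_eq_getD_sort h, h2]; rfl

theorem nthSmall_of_card (S : Finset ℕ) (x k : ℕ) (hx : x ∈ S)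
    (h : (S.filter (· ≤ x)).card = k + 1) : nthSmall S k = x := by
  have h1 : Nat.count (· ∈ S) x = k := by
    have h2 : Nat.count (· ∈ S) (x+1) = k + 1 := by
      rw [Nat.count_eq_card_filter_range, ← h]
      congr 1; ext y; simp [Nat.lt_succ_iff, and_comm]
    rw [Nat.count_succ] at h2; simp [hx] at h2; exact h2
  rw [nthSmall_eq, ← h1]
  exact Nat.nth_count (p := (· ∈ S)) hx

theorem nthSmall_spec (S : Finset ℕ) (k : ℕ) (hk : k < S.card) :
    nthSmall S k ∈ S ∧ (S.filter (· ≤ nthSmall S k)).card = k + 1 := by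
  have h : Set.Finite {x | x ∈ S} := S.finite_toSet
  have h2 : h.toFinset = S := by ext; simp
  rw [nthSmall_eq]
  refine ⟨Nat.nth_mem_of_lt_card (p := (· ∈ S)) h (by rw [h2]; exact hk), ?_⟩
  have := Nat.count_nth_succ (p := (· ∈ S)) (n := k) (fun hf => by
    have : hf.toFinset = S := by ext; simp
    rw [this]; exact hk)
  rw [← this, Nat.count_eq_card_filter_range]
  congr 1; ext y; simp [Nat.lt_succ_iff, and_comm]

theorem tauP_image (I J : Finset ℕ) (hIJ : I ⊆ J) (h1 : ∀ i ∈ I, 1 ≤ i) (x k : ℕ) (hx : x ∈ I)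
    (hk : (I.filter (· ≤ x)).card + k = I.card) :
    tauP (I.image (fun i => (J ∩ Finset.Icc 1 i).card)) k =
      ((J \ I) ∩ Finset.Icc 1 x).card := by
  set f : ℕ → ℕ := fun i => (J ∩ Finset.Icc 1 i).card with hf
  have hlt : ∀ i j, j ∈ I → i < j → f i < f j := by
    intro i j hj hij
    apply Finset.card_lt_card
    rw [Finset.ssubset_iff_of_subset]
    · exact ⟨j, by simp [hIJ hj, h1 j hj], by simp; omega⟩
    · intro y; simp; intro a b c; exact ⟨a, b, by omega⟩
  have hle : ∀ i ∈ I, ∀ j ∈ I, (f i ≤ f j ↔ i ≤ j) := by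
    intro i hi j hj
    constructor
    · intro h; by_contra! hc; have := hlt j i hi hc; omega
    · intro h
      rcases h.eq_or_lt with h | h
      · rw [h]
      · exact (hlt i j hj h).le
  have hinj : Set.InjOn f I := by
    intro i hi j hj h
    exact le_antisymm ((hle i hi j hj).1 h.le) ((hle j hj i hi).1 h.ge)
  have hc : (I.image f).card = I.card := Finset.card_image_of_injOn hinj
  have hc2 : ((I.image f).filter (· ≤ f x)).card = (I.filter (· ≤ x)).card := by
    rw [Finset.filter_image, Finset.card_image_of_injOn]
    · congr 1; apply Finset.filter_congr; intro i hi; exact hle i hi x hx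
    · exact hinj.mono (Finset.coe_subset.2 (Finset.filter_subset _ _))
  have hpos : 0 < (I.filter (· ≤ x)).card := Finset.card_pos.2 ⟨x, by simp [hx]⟩
  have hnth : nthSmall (I.image f) (I.card - 1 - k) = f x := by
    apply nthSmall_of_card _ _ _ (Finset.mem_image_of_mem f hx)
    rw [hc2]; omega
  unfold tauP
  rw [hc, if_pos (by omega), hnth]
  have hs : f x = ((J \ I) ∩ Finset.Icc 1 x).card + (I.filter (· ≤ x)).card := by
    rw [← Finset.card_union_of_disjoint]
    · apply congrArg Finset.card; ext y; simp
      have := @hIJ y; have := h1 y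
      tauto
    · rw [Finset.disjoint_left]; intro y; simp; tauto
  omega

/-- **Lemma (explicit description of `τ(I²)` and `τ(I⁰)`).**
For disjoint `A, A' ⊆ [n]`, let `I = A' ∪ {2n+1−i : i ∈ A} ⊆ [2n]`,
`Ī = {2n+1−i : i ∈ I}`; deleting the letters `2` (positions outside `I ∪ Ī`)
from the 0/1/2-word `χ` of `I` yields `I² ⊆ [2r]` (the rank of `i ∈ I` inside
`I ∪ Ī`), and deleting the letters `0` (positions in `Ī`) yields
`I⁰ ⊆ [2n−r]` (the rank of `i ∈ I` inside `[2n] \ Ī`).  Then `τ(I²)` and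
`τ(I⁰)` are given by the stated explicit formulas. -/
theorem stmt7 (n : ℕ) (A A' : Finset ℕ)
    (hA : A ⊆ Finset.Icc 1 n) (hA' : A' ⊆ Finset.Icc 1 n) (hd : A ∩ A' = ∅)
    (I Ibar I2 I0 : Finset ℕ)
    (hI : I = A' ∪ A.image (fun i => 2 * n + 1 - i))
    (hIbar : Ibar = I.image (fun i => 2 * n + 1 - i))
    (hI2 : I2 = I.image (fun i => ((I ∪ Ibar) ∩ Finset.Icc 1 i).card))
    (hI0 : I0 = I.image (fun i => ((Finset.Icc 1 (2 * n) \ Ibar) ∩ Finset.Icc 1 i).card)) :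
    (∀ k, 1 ≤ k → k ≤ A.card →
      tauP I2 (k - 1) = A.card + (A' ∩ Finset.Icc (nthSmall A (k - 1)) n).card) ∧
    (∀ l, 1 ≤ l → l ≤ A'.card →
      tauP I2 (A.card + l - 1) = (A ∩ Finset.Icc 1 (nthSmall A' (A'.card - l))).card) ∧
    (∀ k, 1 ≤ k → k ≤ A.card →
      tauP I0 (k - 1) = n - A.card - A'.card +
        ((Finset.Icc (nthSmall A (k - 1)) n) \ (A ∪ A')).card) ∧
    (∀ l, 1 ≤ l → l ≤ A'.card →
      tauP I0 (A.card + l - 1) =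
        ((Finset.Icc 1 (nthSmall A' (A'.card - l))) \ (A ∪ A')).card) := by
  have rA : ∀ i ∈ A, 1 ≤ i ∧ i ≤ n := fun i hi => Finset.mem_Icc.1 (hA hi)
  have rA' : ∀ i ∈ A', 1 ≤ i ∧ i ≤ n := fun i hi => Finset.mem_Icc.1 (hA' hi)
  have hdd : ∀ i, i ∈ A → i ∉ A' := fun i h h' => by
    have : i ∈ A ∩ A' := Finset.mem_inter.2 ⟨h, h'⟩
    simp [hd] at this
  have mI : ∀ y, y ∈ I ↔ y ∈ A' ∨ (y ≤ 2 * n ∧ 2 * n + 1 - y ∈ A) := by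
    intro y; rw [hI]; simp only [Finset.mem_union, Finset.mem_image]
    refine or_congr_right ⟨?_, ?_⟩
    · rintro ⟨i, hi, rfl⟩
      have := rA i hi
      refine ⟨by omega, ?_⟩
      rwa [show 2 * n + 1 - (2 * n + 1 - i) = i by omega]
    · rintro ⟨h, h'⟩
      exact ⟨_, h', by omega⟩
  have mB : ∀ y, y ∈ Ibar ↔ y ∈ A ∨ (y ≤ 2 * n ∧ 2 * n + 1 - y ∈ A') := by
    intro y; rw [hIbar]; simp only [Finset.mem_image]
    constructor
    · rintro ⟨i, hi, rfl⟩
      rcases (mI i).1 hi with h | ⟨h, h'⟩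
      · right
        have := rA' i h
        refine ⟨by omega, ?_⟩
        rwa [show 2 * n + 1 - (2 * n + 1 - i) = i by omega]
      · exact Or.inl h'
    · rintro (h | ⟨h, h'⟩)
      · have := rA y h
        refine ⟨2 * n + 1 - y, (mI _).2 (Or.inr ⟨by omega, ?_⟩), by omega⟩
        rwa [show 2 * n + 1 - (2 * n + 1 - y) = y by omega]
      · exact ⟨_, (mI _).2 (Or.inl h'), by omega⟩
  have rI : ∀ i ∈ I, 1 ≤ i ∧ i ≤ 2 * n := by
    intro i hi
    rcases (mI i).1 hi with h | ⟨h, h'⟩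
    · have := rA' i h; omega
    · have := rA _ h'; omega
  have dIB : ∀ i ∈ I, i ∉ Ibar := by
    intro i hi hb
    rcases (mI i).1 hi with h | ⟨h, h'⟩ <;> rcases (mB i).1 hb with g | ⟨g, g'⟩
    · exact hdd i g h
    · have := rA' _ h; have := rA' _ g'; omega
    · have := rA _ h'; have := rA _ g; omega
    · exact hdd _ h' g'
  have cinj : ∀ S : Finset ℕ, (∀ i ∈ S, i ≤ n) →
      (S.image (fun i => 2 * n + 1 - i)).card = S.card := by
    intro S hS
    apply Finset.card_image_of_injOn
    intro i hi j hj h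
    have := hS i hi; have := hS j hj
    simp only at h; omega
  have cI : I.card = A.card + A'.card := by
    rw [hI, Finset.card_union_of_disjoint, cinj A (fun i hi => (rA i hi).2), add_comm]
    rw [Finset.disjoint_left]; intro y hy h
    obtain ⟨i, hi, rfl⟩ := Finset.mem_image.1 h
    have := rA i hi; have := rA' _ hy; omega
  -- rank facts
  have kA : ∀ k, 1 ≤ k → k ≤ A.card → ∃ x, x = 2 * n + 1 - nthSmall A (k-1) ∧ x ∈ I ∧
      nthSmall A (k-1) ∈ A ∧ (I.filter (· ≤ x)).card + (k - 1) = I.card := by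
    intro k h1 h2
    obtain ⟨hm, hc⟩ := nthSmall_spec A (k-1) (by omega)
    set α := nthSmall A (k-1)
    have ha := rA _ hm
    refine ⟨_, rfl, (mI _).2 (Or.inr ⟨by omega, ?_⟩), hm, ?_⟩
    · rwa [show 2 * n + 1 - (2 * n + 1 - α) = α by omega]
    have e : (I.filter (fun y => ¬ y ≤ 2 * n + 1 - α)) =
        ((A.filter (· ≤ α)).erase α).image (fun i => 2 * n + 1 - i) := by
      ext y
      simp only [Finset.mem_filter, Finset.mem_image, Finset.mem_erase, mI]
      constructor
      · rintro ⟨h | ⟨h, h'⟩, g⟩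
        · have := rA' _ h; omega
        · exact ⟨_, ⟨by omega, h', by omega⟩, by omega⟩
      · rintro ⟨i, ⟨h, h', h''⟩, rfl⟩
        have := rA _ h'
        refine ⟨Or.inr ⟨by omega, ?_⟩, by omega⟩
        rwa [show 2 * n + 1 - (2 * n + 1 - i) = i by omega]
    have e2 := Finset.card_filter_add_card_filter_not (s := I) (fun y => y ≤ 2 * n + 1 - α)
    rw [e, cinj, Finset.card_erase_of_mem (by simp [hm]), hc] at e2
    · omega
    · intro i hi; simp at hi; exact (rA i hi.2.1).2
  have lA : ∀ l, 1 ≤ l → l ≤ A'.card → nthSmall A' (A'.card - l) ∈ A' ∧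
      nthSmall A' (A'.card - l) ∈ I ∧
      (I.filter (· ≤ nthSmall A' (A'.card - l))).card + (A.card + l - 1) = I.card := by
    intro l h1 h2
    obtain ⟨hm, hc⟩ := nthSmall_spec A' (A'.card - l) (by omega)
    set α := nthSmall A' (A'.card - l)
    have ha := rA' _ hm
    refine ⟨hm, (mI _).2 (Or.inl hm), ?_⟩
    have e : I.filter (· ≤ α) = A'.filter (· ≤ α) := by
      ext y
      simp only [Finset.mem_filter, mI]
      constructor
      · rintro ⟨h | ⟨h, h'⟩, g⟩
        · exact ⟨h, g⟩
        · have := rA _ h'; omega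
      · rintro ⟨h, g⟩; exact ⟨Or.inl h, g⟩
    rw [e, hc, cI]; omega
  have s2 : I ⊆ I ∪ Ibar := Finset.subset_union_left
  have s0 : I ⊆ Finset.Icc 1 (2 * n) \ Ibar := by
    intro i hi; simp only [Finset.mem_sdiff, Finset.mem_Icc]; exact ⟨rI i hi, dIB i hi⟩
  have pI : ∀ i ∈ I, 1 ≤ i := fun i hi => (rI i hi).1
  refine ⟨?_, ?_, ?_, ?_⟩
  · intro k h1 h2
    obtain ⟨x, hx, hxI, hm, hc⟩ := kA k h1 h2
    rw [hI2, tauP_image I _ s2 pI x _ hxI hc]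
    set α := nthSmall A (k-1)
    have ha := rA _ hm
    rw [← cinj (A' ∩ Finset.Icc α n) (by intro i hi; simp at hi; omega),
      ← Finset.card_union_of_disjoint]
    · congr 1; ext y
      simp only [Finset.mem_inter, Finset.mem_sdiff, Finset.mem_union, Finset.mem_Icc,
        Finset.mem_image]
      constructor
      · rintro ⟨⟨h | h, h'⟩, g⟩
        · exact absurd h h'
        · rcases (mB y).1 h with h | ⟨h, h''⟩
          · exact Or.inl h
          · have := rA' _ h''
            exact Or.inr ⟨_, ⟨h'', by omega⟩, by omega⟩
      · intro h
        have hb : y ∈ Ibar := by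
          rw [mB]
          rcases h with h | ⟨i, ⟨h, h'⟩, rfl⟩
          · exact Or.inl h
          · refine Or.inr ⟨by have := rA' i h; omega, ?_⟩
            rwa [show 2 * n + 1 - (2 * n + 1 - i) = i by omega]
        refine ⟨⟨Or.inr hb, fun h => dIB _ h hb⟩, ?_⟩
        rcases h with h | ⟨i, ⟨h, h'⟩, rfl⟩
        · have := rA _ h; omega
        · omega
    · rw [Finset.disjoint_left]; intro y hy h
      simp only [Finset.mem_inter, Finset.mem_Icc, Finset.mem_image] at h
      obtain ⟨i, ⟨h, h'⟩, rfl⟩ := h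
      have := rA _ hy; omega
  · intro l h1 h2
    obtain ⟨hm, hxI, hc⟩ := lA l h1 h2
    rw [hI2, tauP_image I _ s2 pI _ _ hxI hc]
    set α := nthSmall A' (A'.card - l)
    have ha := rA' _ hm
    congr 1; ext y
    simp only [Finset.mem_inter, Finset.mem_sdiff, Finset.mem_union, Finset.mem_Icc]
    constructor
    · rintro ⟨⟨h | h, h'⟩, g⟩
      · exact absurd h h'
      · rcases (mB y).1 h with h | ⟨h, h''⟩
        · exact ⟨h, g⟩
        · have := rA' _ h''; omega
    · rintro ⟨h, g⟩
      have hb : y ∈ Ibar := (mB y).2 (Or.inl h)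
      exact ⟨⟨Or.inr hb, fun h => dIB _ h hb⟩, g⟩
  · intro k h1 h2
    obtain ⟨x, hx, hxI, hm, hc⟩ := kA k h1 h2
    rw [hI0, tauP_image I _ s0 pI x _ hxI hc]
    set α := nthSmall A (k-1)
    have ha := rA _ hm
    have e : n - A.card - A'.card = (Finset.Icc 1 n \ (A ∪ A')).card := by
      rw [Finset.card_sdiff_of_subset (Finset.union_subset hA hA'),
        Finset.card_union_of_disjoint (Finset.disjoint_left.2 hdd)]
      simp; omega
    rw [e, ← cinj (Finset.Icc α n \ (A ∪ A')) (by intro i hi; simp at hi; omega),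
      ← Finset.card_union_of_disjoint]
    · congr 1; ext y
      simp only [Finset.mem_inter, Finset.mem_sdiff, Finset.mem_union, Finset.mem_Icc,
        Finset.mem_image, mI, mB, not_or, not_and]
      constructor
      · rintro ⟨⟨⟨g, h1, h2⟩, h3, h4⟩, g'⟩
        by_cases hy : y ≤ n
        · exact Or.inl ⟨⟨g.1, hy⟩, h1, h3⟩
        · exact Or.inr ⟨2 * n + 1 - y, ⟨by omega, h4 g.2, h2 g.2⟩, by omega⟩
      · rintro (⟨g, h, h'⟩ | ⟨i, ⟨g, h, h'⟩, rfl⟩)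
        · refine ⟨⟨⟨by omega, h, fun _ q => ?_⟩, h', fun _ q => ?_⟩, by omega⟩
          · have := rA' _ q; omega
          · have := rA _ q; omega
        · rw [show 2 * n + 1 - (2 * n + 1 - i) = i by omega]
          refine ⟨⟨⟨by omega, fun q => ?_, fun _ => h'⟩, fun q => ?_, fun _ => h⟩, by omega⟩
          · have := rA _ q; omega
          · have := rA' _ q; omega
    · rw [Finset.disjoint_left]; intro y hy h
      simp only [Finset.mem_sdiff, Finset.mem_Icc, Finset.mem_image] at h hy
      obtain ⟨i, ⟨h, h'⟩, rfl⟩ := h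
      omega
  · intro l h1 h2
    obtain ⟨hm, hxI, hc⟩ := lA l h1 h2
    rw [hI0, tauP_image I _ s0 pI _ _ hxI hc]
    set α := nthSmall A' (A'.card - l)
    have ha := rA' _ hm
    congr 1; ext y
    simp only [Finset.mem_inter, Finset.mem_sdiff, Finset.mem_union, Finset.mem_Icc, mI, mB,
      not_or, not_and]
    constructor
    · rintro ⟨⟨⟨g, h1, h2⟩, h3, h4⟩, g'⟩
      exact ⟨g', h1, h3⟩
    · rintro ⟨g, h, h'⟩
      refine ⟨⟨⟨by omega, h, fun _ q => ?_⟩, h', fun _ q => ?_⟩, g⟩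
      · have := rA' _ q; omega
      · have := rA _ q; omega
end

section
/- Let λ,μ,ν ∈ Par_n and let a,b,k be nonnegative integers with a+b ≥ ν_1 − k, a ≥ μ_1 − k, and b ≥ λ_1 − k. Then c^{(a+b+k)^n ∪ ν}_{λ+a^n, μ+b^n} = c^{ν+k^n}_{λ,μ}. -/
/-- `λ + a^n`: add `a` to each of the first `n` parts. -/
def addRect (n a : ℕ) (f : ℕ → ℕ) : ℕ → ℕ := fun i =>
  if i < n then f i + a else 0

/-- `c^ℓ ∪ ν`: prepend `ℓ` parts equal to `c` to `ν`. -/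
def prepend (c l : ℕ) (f : ℕ → ℕ) : ℕ → ℕ := fun i =>
  if i < l then c else f (i - l)

open Finset

structure GP (N : ℕ) (lam mu nu : ℕ → ℕ) (P : ℕ → ℕ → ℤ) : Prop where
  zero : ∀ i, P i 0 = lam i
  top : ∀ i m, i + 1 ≤ m → P i m = nu i
  mono : ∀ i m, P i m ≤ P i (m+1)
  strict : ∀ i m, P (i+1) (m+1) ≤ P i m
  content : ∀ m, ∑ i ∈ range N, P i (m+1) = ∑ i ∈ range N, P i m + mu m
  ballot : ∀ i m, ∑ i' ∈ range (i+1), P i' (m+2) + ∑ i' ∈ range i, P i' m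
      ≤ ∑ i' ∈ range (i+1), P i' (m+1) + ∑ i' ∈ range i, P i' (m+1)

structure LRRel (lam nu : ℕ → ℕ) (T P : ℕ → ℕ → ℕ) : Prop where
  zero : ∀ i, P i 0 = lam i
  mono : ∀ i m, P i m ≤ P i (m+1)
  le : ∀ i m, P i m ≤ nu i
  off : ∀ i j, nu i ≤ j → T i j = 0
  key : ∀ i j m, j < nu i → (T i j ≤ m ↔ j < P i m)

lemma ncard_rows (I : ℕ) (A B : ℕ → ℕ) :
    {p : ℕ × ℕ | p.1 < I ∧ A p.1 ≤ p.2 ∧ p.2 < B p.1}.ncard = ∑ i ∈ range I, (B i - A i) := by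
  have : {p : ℕ × ℕ | p.1 < I ∧ A p.1 ≤ p.2 ∧ p.2 < B p.1} =
      ↑(((range I).sigma fun i => Ico (A i) (B i)).map (Equiv.sigmaEquivProd ℕ ℕ).toEmbedding) := by
    ext ⟨x, y⟩
    simp [Equiv.sigmaEquivProd]
  rw [this, Set.ncard_coe_finset, card_map, card_sigma]
  simp

lemma LRRel.lamle {lam nu : ℕ → ℕ} {T P : ℕ → ℕ → ℕ} (h : LRRel lam nu T P) (i m : ℕ) :
    lam i ≤ P i m := by
  induction m with
  | zero => rw [h.zero]
  | succ m ih => exact ih.trans (h.mono i m)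

lemma LRRel.cell {lam nu : ℕ → ℕ} {T P : ℕ → ℕ → ℕ} (h : LRRel lam nu T P) (i j m : ℕ) :
    (InSkew lam nu i j ∧ T i j = m+1) ↔ (P i m ≤ j ∧ j < P i (m+1)) := by
  unfold InSkew
  have h0 := h.lamle i m
  have h1 := h.le i (m+1)
  constructor
  · rintro ⟨⟨a, b⟩, c⟩
    have k1 := h.key i j m b
    have k2 := h.key i j (m+1) b
    omega
  · rintro ⟨a, b⟩
    have k1 := h.key i j m (by omega)
    have k2 := h.key i j (m+1) (by omega)
    omega

lemma LRRel.count {lam nu : ℕ → ℕ} {T P : ℕ → ℕ → ℕ} (h : LRRel lam nu T P) (N m : ℕ)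
    (hN : ∀ i, N ≤ i → nu i = 0) :
    {p : ℕ × ℕ | InSkew lam nu p.1 p.2 ∧ T p.1 p.2 = m + 1}.ncard
      = ∑ i ∈ range N, (P i (m+1) - P i m) := by
  rw [← ncard_rows N (fun i => P i m) (fun i => P i (m+1))]
  congr 1
  ext ⟨i, j⟩
  simp only [Set.mem_ofPred_eq, h.cell]
  constructor
  · rintro ⟨a, b⟩
    refine ⟨?_, a, b⟩
    by_contra hc
    have := hN i (by omega)
    have := h.le i (m+1)
    omega
  · tauto

lemma LRRel.countB {lam nu : ℕ → ℕ} {T P : ℕ → ℕ → ℕ} (h : LRRel lam nu T P) (m : ℕ) (i j : ℕ) :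
    {p : ℕ × ℕ | InSkew lam nu p.1 p.2 ∧ T p.1 p.2 = m + 1 ∧ ReadBefore p (i, j)}.ncard
      = ∑ i' ∈ range i, (P i' (m+1) - P i' m) + (P i (m+1) - max (P i m) j) := by
  have := ncard_rows (i+1) (fun i' => if i' = i then max (P i m) j else P i' m) (fun i => P i (m+1))
  rw [sum_range_succ] at this
  simp only [if_true] at this
  rw [sum_congr rfl (g := fun i' => P i' (m+1) - P i' m)] at this
  · rw [← this]
    congr 1
    ext ⟨x, y⟩
    simp only [Set.mem_ofPred_eq, ← and_assoc, h.cell, ReadBefore]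
    by_cases hx : x = i
    · subst hx; simp; omega
    · simp [hx]; omega
  · intro x hx
    have : x ≠ i := by have := mem_range.1 hx; omega
    simp [this]

lemma castsum (P : ℕ → ℕ → ℕ) (hm : ∀ i m, P i m ≤ P i (m+1)) (I m : ℕ) :
    ((∑ i ∈ range I, (P i (m+1) - P i m) : ℕ) : ℤ) =
      ∑ i ∈ range I, (P i (m+1) : ℤ) - ∑ i ∈ range I, (P i m : ℤ) := by
  rw [← sum_sub_distrib]
  push_cast
  apply sum_congr rfl
  intro i _
  rw [Nat.cast_sub (hm i m)]

lemma LRRel.iff {lam mu nu : ℕ → ℕ} {T P : ℕ → ℕ → ℕ} (h : LRRel lam nu T P) (N : ℕ)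
    (hN : ∀ i, N ≤ i → nu i = 0) (hl : IsPartition lam) (hm : IsPartition mu)
    (hv : IsPartition nu) :
    IsLRTableau lam mu nu T ↔ GP N lam mu nu (fun i m => (P i m : ℤ)) := by
  have hC := castsum P h.mono
  constructor
  · rintro ⟨-, -, -, hle, hoff, hpos, hrow, hcol, hcont, hbal⟩
    have hb : ∀ i m, ∑ i' ∈ range (i+1), (P i' (m+2) - P i' (m+1)) ≤
        ∑ i' ∈ range i, (P i' (m+1) - P i' m) := by
      intro i m
      induction i with
      | zero =>
        by_cases hc : P 0 (m+1) < P 0 (m+2)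
        · have hq := (h.cell 0 (P 0 (m+1)) (m+1)).2 ⟨le_refl _, hc⟩
          have := hbal m (0, P 0 (m+1)) hq.1 hq.2
          rw [h.countB, h.countB] at this
          simp at this
          have := h.mono 0 m
          simp
          omega
        · simp; omega
      | succ i ih =>
        by_cases hc : P (i+1) (m+1) < P (i+1) (m+2)
        · have hq := (h.cell (i+1) (P (i+1) (m+1)) (m+1)).2 ⟨le_refl _, hc⟩
          have := hbal m (i+1, P (i+1) (m+1)) hq.1 hq.2
          rw [h.countB, h.countB] at this
          rw [sum_range_succ]
          have e := h.mono (i+1) m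
          have e2 : max (P (i+1) m) (P (i+1) (m+1)) = P (i+1) (m+1) := max_eq_right e
          rw [e2, max_self] at this
          simp only [add_assoc, Nat.reduceAdd] at this ⊢
          omega
        · rw [sum_range_succ _ (i+1)]
          have := sum_range_succ (fun i' => P i' (m+1) - P i' m) i
          omega
    have hz : ∀ i m, i ≤ m → ∑ i' ∈ range i, (P i' (m+1) - P i' m) = 0 := by
      intro i
      induction i with
      | zero => simp
      | succ i ih =>
        intro m him
        obtain ⟨m, rfl⟩ : ∃ t, m = t + 1 := ⟨m - 1, by omega⟩
        have := hb i m
        rw [ih m (by omega)] at this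
        exact Nat.le_zero.1 this
    have hst : ∀ i m, i + 1 ≤ m → P i m = P i (m+1) := by
      intro i m him
      have := hz (i+1) m him
      rw [sum_range_succ] at this
      have := h.mono i m
      omega
    have hev : ∀ i, ∃ M, ∀ m, M ≤ m → P i m = nu i := by
      intro i
      refine ⟨∑ j ∈ range (nu i), T i j, fun m hM => ?_⟩
      by_contra hc
      have h1 := h.le i m
      have h2 := (h.key i (P i m) m (by omega)).1
      have h3 : T i (P i m) ≤ ∑ j ∈ range (nu i), T i j :=
        single_le_sum (f := fun j => T i j) (fun _ _ => Nat.zero_le _)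
          (mem_range.2 (by omega))
      have := h2 (by omega)
      omega
    refine ⟨fun i => by simp [h.zero], ?_, fun i m => by exact_mod_cast h.mono i m, ?_, ?_, ?_⟩
    · intro i m him
      obtain ⟨M, hM⟩ := hev i
      have : ∀ t, P i m = P i (m+t) := by
        intro t
        induction t with
        | zero => rfl
        | succ t ih => rw [ih, ← add_assoc]; exact hst i (m+t) (by omega)
      show (P i m : ℤ) = nu i
      rw [this M, hM (m+M) (by omega)]
    · intro i m
      have : P (i+1) (m+1) ≤ P i m := by
        by_contra hc
        push Not at hc
        have a1 := h.le (i+1) (m+1)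
        have a2 := hv.1 i (i+1) (by omega)
        have a3 := hl.1 i (i+1) (by omega)
        have a4 := h.lamle i m
        have b1 := (h.key (i+1) (P i m) (m+1) (by omega)).2 hc
        have b2 := hcol i (i+1) (P i m) ⟨by omega, by omega⟩ ⟨by omega, by omega⟩ (by omega)
        have b3 := (h.key i (P i m) m (by omega)).1 (by omega)
        omega
      exact_mod_cast this
    · intro m
      have := hcont m
      rw [h.count N m hN] at this
      have h2 := hC N m
      rw [this] at h2
      show ∑ i ∈ range N, (P i (m+1) : ℤ) = ∑ i ∈ range N, (P i m : ℤ) + mu m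
      linarith
    · intro i m
      have h1 := hC (i+1) (m+1)
      have h2 := hC i m
      have h3 := hb i m
      simp only [add_assoc, Nat.reduceAdd] at h1
      zify at h3
      push_cast at h1 h2 h3
      linarith
  · intro g
    have hst : ∀ i m, P (i+1) (m+1) ≤ P i m := fun i m => by exact_mod_cast g.strict i m
    have hb : ∀ i m, ∑ i' ∈ range (i+1), (P i' (m+2) - P i' (m+1)) ≤
        ∑ i' ∈ range i, (P i' (m+1) - P i' m) := by
      intro i m
      have h1 := hC (i+1) (m+1)
      have h2 := hC i m
      have h3 := g.ballot i m
      simp only [add_assoc, Nat.reduceAdd] at h1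
      zify
      push_cast at h1 h2 h3
      linarith
    have hpos : ∀ i j, InSkew lam nu i j → 1 ≤ T i j := by
      rintro i j ⟨a, b⟩
      by_contra hc
      have := (h.key i j 0 b).1 (by omega)
      rw [h.zero] at this
      omega
    refine ⟨hl, hm, hv, fun i => (h.lamle i 0).trans (h.le i 0), ?_, hpos, ?_, ?_, ?_, ?_⟩
    · intro i j hij
      by_cases hj : j < nu i
      · have hj2 : j < lam i := by
          by_contra hc
          exact hij ⟨by omega, hj⟩
        have := (h.key i j 0 hj).2 (by rw [h.zero]; exact hj2)
        omega
      · exact h.off i j (by omega)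
    · rintro i j j' ⟨a, b⟩ ⟨a', b'⟩ hjj
      have := (h.key i j' _ b').1 le_rfl
      exact (h.key i j _ b).2 (by omega)
    · rintro i i' j ⟨a, b⟩ ⟨a', b'⟩ hii
      have step : ∀ x, i ≤ x → x + 1 ≤ i' → T x j < T (x+1) j := by
        intro x hx hx'
        have n1 := hv.1 (x+1) i' (by omega)
        have n2 := hv.1 x (x+1) (by omega)
        have l1 := hl.1 i (x+1) (by omega)
        have p := hpos (x+1) j ⟨by omega, by omega⟩
        obtain ⟨m, hm⟩ : ∃ t, T (x+1) j = t + 1 := ⟨T (x+1) j - 1, by omega⟩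
        have := (h.key (x+1) j (m+1) (by omega)).1 (by omega)
        have h3 := hst x m
        have := (h.key x j m (by omega)).2 (by omega)
        omega
      have : ∀ t, i + (t+1) ≤ i' → T i j < T (i+(t+1)) j := by
        intro t
        induction t with
        | zero => intro ht; exact step i le_rfl ht
        | succ t ih =>
          intro ht
          exact (ih (by omega)).trans (step (i+(t+1)) (by omega) (by omega))
      have := this (i' - i - 1) (by omega)
      rwa [show i + (i' - i - 1 + 1) = i' by omega] at this
    · intro m
      rw [h.count N m hN]
      have h2 := hC N m
      have h3 := g.content m
      zify
      push_cast at h2 h3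
      linarith
    · rintro m ⟨i, j⟩ hs hT
      have hc := (h.cell i j (m+1)).1 ⟨hs, hT⟩
      rw [h.countB, h.countB]
      have h3 := hb i m
      rw [sum_range_succ] at h3
      simp only [add_assoc, Nat.reduceAdd] at h3 hc ⊢
      have : max (P i (m+1)) j = j := max_eq_right hc.1
      rw [this]
      omega

lemma card_down (M : ℕ) (p : ℕ → Prop) [DecidablePred p]
    (hp : ∀ a b, a ≤ b → b < M → p b → p a) (j : ℕ) (hj : j < M) :
    p j ↔ j < ((range M).filter p).card := by
  constructor
  · intro h
    have : range (j+1) ⊆ (range M).filter p := by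
      intro x hx
      have := mem_range.1 hx
      simp only [mem_filter, mem_range]
      exact ⟨by omega, hp x j (by omega) hj h⟩
    have := card_le_card this
    rw [card_range] at this
    omega
  · intro h
    by_contra hc
    have : (range M).filter p ⊆ range j := by
      intro x hx
      simp only [mem_filter, mem_range] at hx ⊢
      by_contra hx2
      exact hc (hp j x (by omega) hx.1 hx.2)
    have := card_le_card this
    rw [card_range] at this
    omega

def Pof (nu : ℕ → ℕ) (T : ℕ → ℕ → ℕ) : ℕ → ℕ → ℕ := fun i m =>
  ((range (nu i)).filter (fun j => T i j ≤ m)).card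

def Tof (nu : ℕ → ℕ) (P : ℕ → ℕ → ℕ) : ℕ → ℕ → ℕ := fun i j =>
  if j < nu i then ((range (i+1)).filter (fun m => P i m ≤ j)).card else 0

lemma rel_Pof {lam mu nu : ℕ → ℕ} {T : ℕ → ℕ → ℕ} (h : IsLRTableau lam mu nu T) :
    LRRel lam nu T (Pof nu T) := by
  obtain ⟨-, -, -, hle, hoff, hpos, hrow, -⟩ := h
  have hmono : ∀ i j j', j ≤ j' → j' < nu i → T i j ≤ T i j' := by
    intro i j j' hj hj'
    by_cases hl : j < lam i
    · rw [hoff i j (fun hc => by have := hc.1; omega)]; omega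
    · exact hrow i j j' ⟨by omega, by omega⟩ ⟨by omega, by omega⟩ hj
  have hkey : ∀ i j m, j < nu i → (T i j ≤ m ↔ j < Pof nu T i m) := by
    intro i j m hj
    exact card_down (nu i) (fun j => T i j ≤ m)
      (fun a b hab hb hp => (hmono i a b hab hb).trans hp) j hj
  have hlen : ∀ i m, Pof nu T i m ≤ nu i := by
    intro i m
    unfold Pof
    calc _ ≤ (range (nu i)).card := card_filter_le _ _
      _ = _ := card_range _
  refine ⟨?_, ?_, hlen, ?_, hkey⟩
  · intro i
    have : (range (nu i)).filter (fun j => T i j ≤ 0) = range (lam i) := by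
      ext j
      simp only [mem_filter, mem_range]
      have := hle i
      constructor
      · rintro ⟨a, b⟩
        by_contra hc
        have := hpos i j ⟨by omega, a⟩
        omega
      · intro hj
        refine ⟨by omega, ?_⟩
        rw [hoff i j (fun hc => by have := hc.1; omega)]
    unfold Pof
    rw [this, card_range]
  · intro i m
    apply card_le_card
    intro j
    simp only [mem_filter, mem_range]
    omega
  · intro i j hj
    exact hoff i j (fun hc => by have := hc.2; omega)

lemma rel_Tof {N : ℕ} {lam mu nu : ℕ → ℕ} {P : ℕ → ℕ → ℕ}
    (g : GP N lam mu nu (fun i m => (P i m : ℤ))) :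
    LRRel lam nu (Tof nu P) P := by
  have hm : ∀ i m, P i m ≤ P i (m+1) := fun i m => by exact_mod_cast g.mono i m
  have ht : ∀ i m, i + 1 ≤ m → P i m = nu i := fun i m h => by exact_mod_cast g.top i m h
  have hmm : ∀ i, Monotone (P i) := fun i => monotone_nat_of_le_succ (hm i)
  refine ⟨fun i => by exact_mod_cast g.zero i, hm, ?_, ?_, ?_⟩
  · intro i m
    have := hmm i (le_max_left m (i+1))
    rw [ht i _ (le_max_right _ _)] at this
    exact this
  · intro i j hj
    simp [Tof, hj]
  · intro i j m hj
    simp only [Tof, hj, if_true]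
    by_cases him : m < i + 1
    · have := card_down (i+1) (fun m => P i m ≤ j)
        (fun a b hab hb hp => (hmm i hab).trans hp) m him
      omega
    · rw [ht i m (by omega)]
      have : ((range (i+1)).filter (fun m => P i m ≤ j)).card ≤ (range (i+1)).card :=
        card_filter_le _ _
      rw [card_range] at this
      omega

lemma LRRel.uniqP {lam nu : ℕ → ℕ} {T P P' : ℕ → ℕ → ℕ} (h : LRRel lam nu T P)
    (h' : LRRel lam nu T P') : P = P' := by
  funext i m
  have a := h.le i m
  have b := h'.le i m
  have c := h.key i (P i m) m
  have c' := h'.key i (P i m) m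
  have d := h.key i (P' i m) m
  have d' := h'.key i (P' i m) m
  by_contra hc
  rcases Nat.lt_or_gt_of_ne hc with hc | hc
  · have := c (by omega); have := c' (by omega); omega
  · have := d (by omega); have := d' (by omega); omega

lemma LRRel.uniqT {lam nu : ℕ → ℕ} {T T' P : ℕ → ℕ → ℕ} (h : LRRel lam nu T P)
    (h' : LRRel lam nu T' P) : T = T' := by
  funext i j
  by_cases hj : j < nu i
  · apply le_antisymm
    · exact (h.key i j _ hj).2 ((h'.key i j _ hj).1 le_rfl)
    · exact (h'.key i j _ hj).2 ((h.key i j _ hj).1 le_rfl)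
  · rw [h.off i j (by omega), h'.off i j (by omega)]

lemma GP.nonneg {N : ℕ} {lam mu nu : ℕ → ℕ} {P : ℕ → ℕ → ℤ} (g : GP N lam mu nu P) (i m : ℕ) :
    0 ≤ P i m := by
  induction m with
  | zero => rw [g.zero]; positivity
  | succ m ih => exact ih.trans (g.mono i m)

theorem lr_eq_GP (N : ℕ) (lam mu nu : ℕ → ℕ)
    (hN : ∀ i, N ≤ i → nu i = 0) (hl : IsPartition lam) (hm : IsPartition mu)
    (hv : IsPartition nu) :
    lrCoeff lam mu nu = Nat.card {P : ℕ → ℕ → ℤ // GP N lam mu nu P} := by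
  unfold lrCoeff
  have tn : ∀ {P : ℕ → ℕ → ℤ}, GP N lam mu nu P →
      (fun i m => (((fun i m => (P i m).toNat) i m : ℕ) : ℤ)) = P := by
    intro P g
    funext i m
    exact Int.toNat_of_nonneg (g.nonneg i m)
  have tn' : ∀ {P : ℕ → ℕ → ℤ}, GP N lam mu nu P →
      GP N lam mu nu (fun i m => (((fun i m => (P i m).toNat) i m : ℕ) : ℤ)) := by
    intro P g
    rw [tn g]; exact g
  refine Nat.card_congr ⟨fun T => ⟨fun i m => (Pof nu T.1 i m : ℤ), ?_⟩,
    fun P => ⟨Tof nu (fun i m => (P.1 i m).toNat), ?_⟩, ?_, ?_⟩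
  · exact ((rel_Pof T.2).iff N hN hl hm hv).1 T.2
  · exact ((rel_Tof (tn' P.2)).iff N hN hl hm hv).2 (tn' P.2)
  · rintro ⟨T, hT⟩
    apply Subtype.ext
    have r := rel_Pof hT
    have g := (r.iff N hN hl hm hv).1 hT
    have r' := rel_Tof g
    simpa using r'.uniqT r
  · rintro ⟨P, hP⟩
    apply Subtype.ext
    have g := tn' hP
    have r := rel_Tof g
    have r' := rel_Pof ((r.iff N hN hl hm hv).2 g)
    have := r'.uniqP r
    show (fun i m => (Pof nu (Tof nu (fun i m => (P i m).toNat)) i m : ℤ)) = P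
    rw [this]
    exact tn hP

structure QP (n : ℕ) (lam mu nu : ℕ → ℕ) (k : ℕ) (Q : ℕ → ℕ → ℤ) : Prop where
  low : ∀ j m, m ≤ j → Q j m = 0
  high : ∀ j m, n ≤ m → Q j m = nu j
  mono : ∀ j m, Q j m ≤ Q j (m+1)
  strict : ∀ j m, Q (j+1) (m+1) ≤ Q j m
  content : ∀ m d, m + d + 1 = n →
    ∑ j ∈ range n, Q j (m+1) = ∑ j ∈ range n, Q j m + mu m + lam d - k
  ballot : ∀ j m d, m + d + 2 = n → j ≤ m →
    ∑ j' ∈ range (j+1), Q j' (m+2) - ∑ j' ∈ range (j+1), Q j' (m+1) + lam (d+1) ≤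
      lam d + ∑ j' ∈ range j, Q j' (m+1) - ∑ j' ∈ range j, Q j' m

def QofP (n : ℕ) (nu : ℕ → ℕ) (k : ℕ) (P : ℕ → ℕ → ℤ) : ℕ → ℕ → ℤ := fun j m =>
  if m ≤ j then 0 else if n ≤ m then nu j else
    ∑ i ∈ range (j+1+(n-m)), P i (j+1) - ∑ i ∈ range (j+(n-m)), P i j - k

def PofQ (n : ℕ) (lam nu : ℕ → ℕ) (k : ℕ) (Q : ℕ → ℕ → ℤ) : ℕ → ℕ → ℤ := fun i m =>
  if n ≤ i then 0 else if m ≤ i then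
    lam (i-m) - ∑ j ∈ range m, Q j (m+(n-1-i)+1) + ∑ j ∈ range m, Q j (m+(n-1-i))
  else nu i + k

section AQ
variable {n : ℕ} {lam mu nu : ℕ → ℕ} {k : ℕ}

lemma sum_low {Q : ℕ → ℕ → ℤ} (hlow : ∀ j m, m ≤ j → Q j m = 0) (m t : ℕ) (h : m ≤ t) :
    ∑ j ∈ range t, Q j m = ∑ j ∈ range m, Q j m := by
  symm
  apply sum_subset (range_mono h)
  intro x _ hx
  exact hlow x m (by simpa using hx)

lemma QofP_entry {P : ℕ → ℕ → ℤ} (g : GP n lam mu (addRect n k nu) P) (j m d : ℕ)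
    (hd : m + d = n) (hj : j < m) :
    QofP n nu k P j m =
      ∑ i ∈ range (j+1+d), P i (j+1) - ∑ i ∈ range (j+d), P i j - k := by
  unfold QofP
  rw [if_neg (by omega)]
  split_ifs with h
  · obtain rfl : d = 0 := by omega
    simp only [add_zero]
    rw [sum_range_succ]
    have h1 : P j (j+1) = nu j + k := by
      rw [g.top j (j+1) le_rfl]
      simp [addRect, show j < n by omega]
    have h2 : ∑ i ∈ range j, P i (j+1) = ∑ i ∈ range j, P i j := by
      apply sum_congr rfl
      intro i hi
      have := mem_range.1 hi
      rw [g.top i (j+1) (by omega), g.top i j (by omega)]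
    rw [h1, h2]; ring
  · rw [show n - m = d by omega]

lemma QofP_sum {P : ℕ → ℕ → ℤ} (g : GP n lam mu (addRect n k nu) P) (j m d : ℕ)
    (hd : m + d = n) (hj : j ≤ m) :
    ∑ j' ∈ range j, QofP n nu k P j' m =
      ∑ i ∈ range (j+d), P i j - ∑ i ∈ range d, (lam i : ℤ) - j * k := by
  induction j with
  | zero => simp [g.zero]
  | succ j ih =>
    rw [sum_range_succ, ih (by omega), QofP_entry g j m d hd (by omega)]
    push_cast
    ring

lemma QofP_QP (hl : MemParN n lam) (hm : MemParN n mu) (hv : MemParN n nu)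
    {P : ℕ → ℕ → ℤ} (g : GP n lam mu (addRect n k nu) P) :
    QP n lam mu nu k (QofP n nu k P) := by
  have low : ∀ j m, m ≤ j → QofP n nu k P j m = 0 := by
    intro j m h; simp [QofP, h]
  have high : ∀ j m, n ≤ m → QofP n nu k P j m = nu j := by
    intro j m h
    unfold QofP
    split_ifs with h1
    · rw [hv.2 j (by omega)]; rfl
    · rfl
  have strict : ∀ j m, QofP n nu k P (j+1) (m+1) ≤ QofP n nu k P j m := by
    intro j m
    by_cases h : m ≤ j
    · rw [low j m h, low (j+1) (m+1) (by omega)]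
    by_cases h2 : n ≤ m
    · rw [high j m h2, high (j+1) (m+1) (by omega)]
      exact_mod_cast hv.1.1 j (j+1) (by omega)
    obtain ⟨d, hd⟩ : ∃ d, m + (d + 1) = n := ⟨n - m - 1, by omega⟩
    rw [QofP_entry g j m (d+1) hd (by omega), QofP_entry g (j+1) (m+1) d (by omega) (by omega)]
    have := g.ballot (j+1+d) j
    rw [show j + 1 + 1 + d = j+1+d+1 by ring, show j + 1 + (d+1) = j+1+d+1 by ring,
      show j + (d+1) = j+1+d by ring]
    linarith
  have nn : ∀ t j, j + 1 + t = n → 0 ≤ QofP n nu k P j (j+1) := by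
    intro t
    induction t with
    | zero => intro j hj; rw [high j (j+1) (by omega)]; positivity
    | succ t ih => intro j hj; exact (ih (j+1) (by omega)).trans (strict j (j+1))
  have content : ∀ m d, m + d + 1 = n →
      ∑ j ∈ range n, QofP n nu k P j (m+1) = ∑ j ∈ range n, QofP n nu k P j m + mu m + lam d - k := by
    intro m d hd
    rw [sum_low low _ n (by omega), sum_low low _ n (by omega),
      QofP_sum g (m+1) (m+1) d (by omega) le_rfl, QofP_sum g m m (d+1) (by omega) le_rfl,
      show m + 1 + d = n by omega, show m + (d+1) = n by omega, g.content, sum_range_succ]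
    push_cast
    ring
  refine ⟨low, high, ?_, strict, content, ?_⟩
  · intro j m
    by_cases h : m ≤ j
    · rw [low j m h]
      by_cases h2 : m = j
      · subst h2
        by_cases h3 : n ≤ m
        · rw [high m (m+1) (by omega)]; positivity
        · exact nn (n - (m+1)) m (by omega)
      · rw [low j (m+1) (by omega)]
    by_cases h2 : n ≤ m
    · rw [high j m h2, high j (m+1) (by omega)]
    obtain ⟨d, hd⟩ : ∃ d, m + (d + 1) = n := ⟨n - m - 1, by omega⟩
    rw [QofP_entry g j m (d+1) hd (by omega), QofP_entry g j (m+1) d (by omega) (by omega)]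
    rw [show j + 1 + (d+1) = j+1+d+1 by ring, show j + (d+1) = j+d+1 by ring,
      sum_range_succ, sum_range_succ _ (j+d)]
    have := g.strict (j+d) j
    rw [show j + 1 + d = j + d + 1 by ring]
    linarith
  · intro j m d hd hj
    rw [QofP_sum g (j+1) (m+2) d (by omega) (by omega),
      QofP_sum g (j+1) (m+1) (d+1) (by omega) (by omega),
      QofP_sum g j (m+1) (d+1) (by omega) (by omega),
      QofP_sum g j m (d+2) (by omega) (by omega),
      show j + 1 + (d+1) = j+1+d+1 by ring, show j + (d+1) = j+1+d by ring,
      show j + (d+2) = j+1+d+1 by ring]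
    simp only [sum_range_succ]
    have := g.mono (j+1+d) j
    linarith

lemma PofQ_entry {Q : ℕ → ℕ → ℤ} (m d e : ℕ) (h : m + d + e + 1 = n) :
    PofQ n lam nu k Q (m+d) m =
      lam d - ∑ j ∈ range m, Q j (m+e+1) + ∑ j ∈ range m, Q j (m+e) := by
  unfold PofQ
  rw [if_neg (by omega), if_pos (by omega), show m + d - m = d by omega,
    show n - 1 - (m+d) = e by omega]

lemma PofQ_top {Q : ℕ → ℕ → ℤ} (i m : ℕ) (h : i + 1 ≤ m) :
    PofQ n lam nu k Q i m = (addRect n k nu i : ℕ) := by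
  unfold PofQ addRect
  by_cases hi : n ≤ i
  · rw [if_pos hi, if_neg (by omega)]; rfl
  · rw [if_neg hi, if_neg (by omega), if_pos (by omega)]; push_cast; rfl

lemma PofQ_sum {Q : ℕ → ℕ → ℤ} (q : QP n lam mu nu k Q) (d : ℕ) : ∀ (m e : ℕ),
    m + d + e = n → ∑ i ∈ range (m+d), PofQ n lam nu k Q i m =
      ∑ j ∈ range m, Q j (m+e) + ∑ i ∈ range d, (lam i : ℤ) + m * k := by
  induction d with
  | zero =>
    intro m e h
    have h1 : ∀ i ∈ range m, PofQ n lam nu k Q i m = Q i (m+e) + k := by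
      intro i hi
      have := mem_range.1 hi
      rw [PofQ_top i m (by omega), q.high i (m+e) (by omega)]
      simp [addRect, show i < n by omega]
    rw [add_zero, sum_congr rfl h1, sum_add_distrib]
    simp
  | succ d ih =>
    intro m e h
    rw [← add_assoc, sum_range_succ, ih m (e+1) (by omega), PofQ_entry m d e (by omega),
      sum_range_succ]
    rw [← add_assoc m e 1]
    ring

lemma PofQ_GP (hl : MemParN n lam) (hm : MemParN n mu) (hv : MemParN n nu)
    {Q : ℕ → ℕ → ℤ} (q : QP n lam mu nu k Q) :
    GP n lam mu (addRect n k nu) (PofQ n lam nu k Q) := by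
  have zero : ∀ i, PofQ n lam nu k Q i 0 = lam i := by
    intro i
    unfold PofQ
    by_cases h : n ≤ i
    · rw [if_pos h, hl.2 i h]; rfl
    · rw [if_neg h, if_pos (by omega)]; simp
  have tail : ∀ m t i, m + 1 = n → i + t = n →
      ∑ j ∈ range n, (Q j (m+1) - Q j m) ≤ ∑ j ∈ range i, (Q j (m+1) - Q j m) + nu i := by
    intro m t
    induction t with
    | zero => intro i h1 h2; rw [show i = n by omega]; simp
    | succ t ih =>
      intro i h1 h2
      have := ih (i+1) h1 (by omega)
      rw [sum_range_succ _ i, q.high i (m+1) (by omega)] at this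
      have h3 := q.strict i m
      rw [q.high (i+1) (m+1) (by omega)] at h3
      linarith
  have mono : ∀ i m, PofQ n lam nu k Q i m ≤ PofQ n lam nu k Q i (m+1) := by
    intro i m
    by_cases hi : n ≤ i
    · simp [PofQ, hi]
    by_cases h1 : i + 1 ≤ m
    · rw [PofQ_top i m h1, PofQ_top i (m+1) (by omega)]
    by_cases h2 : m = i
    · subst h2
      rw [PofQ_top m (m+1) le_rfl]
      have e1 := PofQ_entry (n := n) (lam := lam) (nu := nu) (k := k) (Q := Q) m 0 (n-1-m) (by omega)
      rw [add_zero] at e1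
      rw [e1, show m + (n-1-m) = n-1 by omega]
      have h3 := tail (n-1) (n-m) m (by omega) (by omega)
      have h4 := q.content (n-1) 0 (by omega)
      simp only [sum_sub_distrib] at h3
      have h5 : (addRect n k nu m : ℤ) = nu m + k := by
        simp [addRect, show m < n by omega]
      rw [h5]
      have h6 : (0:ℤ) ≤ mu (n-1) := by positivity
      linarith
    · obtain ⟨d, rfl⟩ : ∃ d, i = m + (d+1) := ⟨i - m - 1, by omega⟩
      obtain ⟨e, he⟩ : ∃ e, m + (d+1) + e + 1 = n := ⟨n - (m + (d+1)) - 1, by omega⟩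
      rw [PofQ_entry m (d+1) e he, show m + (d+1) = m+1+d by ring,
        PofQ_entry (m+1) d e (by omega)]
      have := q.ballot m (m+e) d (by omega) (by omega)
      rw [show m + 1 + e + 1 = m + e + 2 by ring, show m+1+e = m+e+1 by ring]
      linarith
  have nonneg : ∀ i m, 0 ≤ PofQ n lam nu k Q i m := by
    intro i m
    induction m with
    | zero => rw [zero]; positivity
    | succ m ih => exact ih.trans (mono i m)
  have cont : ∀ m, ∑ i ∈ range n, PofQ n lam nu k Q i (m+1) =
          ∑ i ∈ range n, PofQ n lam nu k Q i m + mu m := by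
    intro m
    by_cases hmn : n ≤ m
    · rw [hm.2 m hmn]
      simp only [Nat.cast_zero, add_zero]
      apply sum_congr rfl
      intro i hi
      have := mem_range.1 hi
      rw [PofQ_top i (m+1) (by omega), PofQ_top i m (by omega)]
    · obtain ⟨d, hd⟩ : ∃ d, m + d + 1 = n := ⟨n - m - 1, by omega⟩
      have h1 := PofQ_sum q (d+1) m 0 (by omega)
      have h2 := PofQ_sum q d (m+1) 0 (by omega)
      have h3 := q.content m d hd
      rw [sum_low q.low _ n (by omega), sum_low q.low _ n (by omega)] at h3
      rw [show m + (d+1) = n by omega, sum_range_succ] at h1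
      rw [show m + 1 + d = n by omega] at h2
      simp only [add_zero] at h1 h2
      push_cast at h1 h2
      linarith
  refine ⟨zero, PofQ_top, mono, ?_, cont, ?_⟩
  · intro i m
    by_cases hi : n ≤ i + 1
    · have : PofQ n lam nu k Q (i+1) (m+1) = 0 := by simp [PofQ, hi]
      rw [this]; exact nonneg i m
    by_cases h1 : i + 1 ≤ m
    · rw [PofQ_top i m h1, PofQ_top (i+1) (m+1) (by omega)]
      have := hv.1.1 i (i+1) (by omega)
      simp only [addRect, show i < n by omega, show i + 1 < n by omega, if_true]
      push_cast
      have : (nu (i+1) : ℤ) ≤ nu i := by exact_mod_cast this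
      linarith
    · obtain ⟨d, rfl⟩ : ∃ d, i = m + d := ⟨i - m, by omega⟩
      obtain ⟨e, he⟩ : ∃ e, m + 1 + d + e + 1 = n := ⟨n - (m + 1 + d) - 1, by omega⟩
      rw [PofQ_entry m d (e+1) (by omega), show m + d + 1 = m+1+d by ring,
        PofQ_entry (m+1) d e (by omega), sum_range_succ, sum_range_succ _ m]
      rw [show m + 1 + e + 1 = m + (e+1) + 1 by ring, show m+1+e = m+(e+1) by ring]
      have := q.mono m (m+(e+1))
      linarith
  · intro i m
    by_cases h1 : i < m + 1
    · have e1 : ∑ i' ∈ range (i+1), PofQ n lam nu k Q i' (m+2) =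
          ∑ i' ∈ range (i+1), PofQ n lam nu k Q i' (m+1) := by
        apply sum_congr rfl
        intro x hx
        have := mem_range.1 hx
        rw [PofQ_top x (m+1) (by omega), PofQ_top x (m+2) (by omega)]
      have e2 : ∑ i' ∈ range i, PofQ n lam nu k Q i' m ≤
          ∑ i' ∈ range i, PofQ n lam nu k Q i' (m+1) :=
        sum_le_sum (fun x _ => mono x m)
      linarith
    by_cases hi : n ≤ i
    · -- rows beyond n vanish
      have cut : ∀ t m, n ≤ t → ∑ i' ∈ range t, PofQ n lam nu k Q i' m =
          ∑ i' ∈ range n, PofQ n lam nu k Q i' m := by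
        intro t m ht
        symm
        apply sum_subset (range_mono ht)
        intro x _ hx
        have : n ≤ x := by simpa using hx
        simp [PofQ, this]
      rw [cut _ _ hi, cut _ _ hi, cut (i+1) _ (by omega), cut (i+1) _ (by omega)]
      have c1 := cont m
      have c2 := cont (m+1)
      have : (mu (m+1) : ℤ) ≤ mu m := by exact_mod_cast hm.1.1 m (m+1) (by omega)
      linarith
    · obtain ⟨d, rfl⟩ : ∃ d, i = m + 1 + d := ⟨i - m - 1, by omega⟩
      obtain ⟨e, he⟩ : ∃ e, m + 1 + d + (e + 1) = n := ⟨n - (m + 1 + d) - 1, by omega⟩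
      have s1 := PofQ_sum q d (m+2) e (by omega)
      have s2 := PofQ_sum q (d+1) m (e+1) (by omega)
      have s3 := PofQ_sum q (d+1) (m+1) e (by omega)
      have s4 := PofQ_sum q d (m+1) (e+1) (by omega)
      have := q.strict m (m+1+e)
      rw [show m + 2 + d = m + 1 + d + 1 by ring, sum_range_succ _ (m+1),
        sum_range_succ _ m] at s1
      rw [show m + (d+1) = m + 1 + d by ring] at s2
      rw [show m + 1 + (d+1) = m + 1 + d + 1 by ring, sum_range_succ _ m] at s3
      rw [sum_range_succ _ m] at s4
      rw [show m + 2 + e = m + 1 + (e + 1) by ring] at s1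
      rw [show m + (e+1) = m + 1 + e by ring] at s2
      rw [show m + 1 + e + 1 = m + 1 + (e+1) by ring] at this
      push_cast at s1 s2 s3 s4
      linarith

lemma QP_PofQ_QofP (hl : MemParN n lam)
    {P : ℕ → ℕ → ℤ} (g : GP n lam mu (addRect n k nu) P) :
    PofQ n lam nu k (QofP n nu k P) = P := by
  funext i m
  by_cases h1 : i + 1 ≤ m
  · rw [PofQ_top i m h1, g.top i m h1]
  by_cases hi : n ≤ i
  · have a1 : 0 ≤ P i m := g.nonneg i m
    have a2 : P i m ≤ P i (i+1) := monotone_nat_of_le_succ (g.mono i) (by omega)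
    rw [g.top i (i+1) le_rfl] at a2
    simp only [addRect, show ¬ i < n by omega, if_false, Nat.cast_zero] at a2
    simp only [PofQ, hi, if_true]
    linarith
  obtain ⟨d, rfl⟩ : ∃ d, i = m + d := ⟨i - m, by omega⟩
  obtain ⟨e, he⟩ : ∃ e, m + d + e + 1 = n := ⟨n - (m + d) - 1, by omega⟩
  rw [PofQ_entry m d e he, QofP_sum g m (m+e+1) d (by omega) (by omega),
    QofP_sum g m (m+e) (d+1) (by omega) (by omega), ← add_assoc, sum_range_succ, sum_range_succ]
  ring

lemma QP_QofP_PofQ (hv : MemParN n nu) {Q : ℕ → ℕ → ℤ} (q : QP n lam mu nu k Q)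
    (g : GP n lam mu (addRect n k nu) (PofQ n lam nu k Q)) :
    QofP n nu k (PofQ n lam nu k Q) = Q := by
  funext j m
  by_cases h1 : m ≤ j
  · rw [q.low j m h1]; simp [QofP, h1]
  by_cases h2 : n ≤ m
  · rw [q.high j m h2]; simp [QofP, h1, h2]
  obtain ⟨d, hd⟩ : ∃ d, m + d = n := ⟨n - m, by omega⟩
  obtain ⟨e, rfl⟩ : ∃ e, m = j + 1 + e := ⟨m - (j+1), by omega⟩
  have s1 := PofQ_sum q d (j+1) e (by omega)
  have s2 := PofQ_sum q d j (e+1) (by omega)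
  rw [QofP_entry g j _ d hd (by omega), s1, s2, sum_range_succ]
  rw [show j + (e+1) = j + 1 + e by ring]
  push_cast
  ring

theorem card_GP_QP (hl : MemParN n lam) (hm : MemParN n mu) (hv : MemParN n nu) :
    Nat.card {P : ℕ → ℕ → ℤ // GP n lam mu (addRect n k nu) P} =
      Nat.card {Q : ℕ → ℕ → ℤ // QP n lam mu nu k Q} :=
  Nat.card_congr ⟨fun P => ⟨QofP n nu k P.1, QofP_QP hl hm hv P.2⟩,
    fun Q => ⟨PofQ n lam nu k Q.1, PofQ_GP hl hm hv Q.2⟩,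
    fun P => Subtype.ext (QP_PofQ_QofP hl P.2),
    fun Q => Subtype.ext (QP_QofP_PofQ hv Q.2 (PofQ_GP hl hm hv Q.2))⟩

end AQ

def RofQ (n : ℕ) (lam : ℕ → ℕ) (a c : ℕ) (Q : ℕ → ℕ → ℤ) : ℕ → ℕ → ℤ := fun i m =>
  if i < n then (if m ≤ i then (lam (i-m) + a : ℤ) else c) else Q (i-n) m

lemma top_diff {n : ℕ} {R : ℕ → ℕ → ℤ} {c : ℤ}
    (shift : ∀ i m, i + 1 < n → R (i+1) (m+1) = R i m) (h0 : ∀ m, 0 < n → R 0 (m+1) = c)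
    (m t : ℕ) (ht : t + 1 = n) :
    ∑ i ∈ range n, R i (m+1) = ∑ i ∈ range n, R i m + c - R t m := by
  subst ht
  rw [sum_range_succ', sum_range_succ, h0 m (by omega)]
  rw [sum_congr rfl (g := fun i => R i m)]
  · ring
  · intro i hi
    have := mem_range.1 hi
    exact shift i m (by omega)

section BQ
variable {n : ℕ} {lam mu nu : ℕ → ℕ} {a b k : ℕ}

lemma part_addRect {f : ℕ → ℕ} (x : ℕ) (hf : MemParN n f) : IsPartition (addRect n x f) := by
  refine ⟨?_, n, ?_⟩
  · intro i j hij
    have := hf.1.1 i j hij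
    unfold addRect
    split_ifs <;> omega
  · intro i hi
    simp [addRect, hi]

lemma part_prepend {f : ℕ → ℕ} {c : ℕ} (hf : MemParN n f) (hc : f 0 ≤ c) :
    IsPartition (prepend c n f) := by
  refine ⟨?_, n + n, ?_⟩
  · intro i j hij
    have h1 := hf.1.1 (i-n) (j-n) (by omega)
    have h2 := hf.1.1 0 (j-n) (by omega)
    unfold prepend
    split_ifs <;> omega
  · intro i hi
    unfold prepend
    rw [if_neg (by omega)]
    exact hf.2 _ (by omega)

lemma forced_shift {N : ℕ} {l' m' nu : ℕ → ℕ} {c : ℕ} {R : ℕ → ℕ → ℤ}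
    (g : GP N l' m' (prepend c n nu) R) (i m : ℕ) (hi : i + 1 < n) :
    R (i+1) (m+1) = R i m := by
  have hstep : ∀ m, ∑ x ∈ range (i+1), (R x m - R (x+1) (m+1)) ≤
      ∑ x ∈ range (i+1), (R x (m+1) - R (x+1) (m+1+1)) := by
    intro m
    have h := g.ballot (i+1) m
    rw [sum_range_succ' _ (i+1), sum_range_succ' _ (i+1), g.top 0 (m+2) (by omega),
      g.top 0 (m+1) (by omega)] at h
    simp only [sum_sub_distrib]
    linarith
  have hz : ∑ x ∈ range (i+1), (R x (m+(i+1)) - R (x+1) (m+(i+1)+1)) = 0 := by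
    apply sum_eq_zero
    intro x hx
    have := mem_range.1 hx
    rw [g.top x _ (by omega), g.top (x+1) _ (by omega)]
    simp [prepend, show x < n by omega, show x + 1 < n by omega]
  have hm : ∑ x ∈ range (i+1), (R x m - R (x+1) (m+1)) ≤
      ∑ x ∈ range (i+1), (R x (m+(i+1)) - R (x+1) (m+(i+1)+1)) :=
    monotone_nat_of_le_succ (f := fun m => ∑ x ∈ range (i+1), (R x m - R (x+1) (m+1)))
      hstep (by omega : m ≤ m + (i+1))
  rw [hz] at hm
  have hnn : ∀ x ∈ range (i+1), 0 ≤ R x m - R (x+1) (m+1) := by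
    intro x _
    have := g.strict x m
    linarith
  have := (sum_eq_zero_iff_of_nonneg hnn).1 (le_antisymm hm (sum_nonneg hnn)) i (by simp)
  linarith

lemma forced_entry {N : ℕ} {m' nu : ℕ → ℕ} {c : ℕ} {R : ℕ → ℕ → ℤ}
    (g : GP N (addRect n a lam) m' (prepend c n nu) R) (m d : ℕ) (hi : m + d < n) :
    R (m+d) m = lam d + a := by
  induction m with
  | zero =>
    rw [g.zero]; simp [addRect, show d < n by omega]
  | succ m ih =>
    rw [show m + 1 + d = m + d + 1 by ring, forced_shift g _ _ (by omega)]
    exact ih (by omega)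

lemma R_QP (hm : MemParN n mu) (hv : MemParN n nu) {R : ℕ → ℕ → ℤ}
    (g : GP (n+n) (addRect n a lam) (addRect n b mu) (prepend (a+b+k) n nu) R) :
    QP n lam mu nu k (fun j m => R (n+j) m) := by
  have shift := fun i m hi => forced_shift g i m hi
  have h0 : ∀ m, 0 < n → R 0 (m+1) = ((a + b + k : ℕ) : ℤ) := by
    intro m hn
    rw [g.top 0 (m+1) (by omega)]
    simp [prepend, hn]
  have td : ∀ m d, m + d + 1 = n →
      ∑ i ∈ range n, R i (m+1) = ∑ i ∈ range n, R i m + b + k - lam d := by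
    intro m d hd
    rw [top_diff shift h0 m (m+d) hd, forced_entry g m d (by omega)]
    push_cast
    ring
  have nut : ∀ j, prepend (a+b+k) n nu (n+j) = nu j := by
    intro j; simp [prepend]
  have ltop : ∀ i m, R i m ≤ prepend (a+b+k) n nu i := by
    intro i m
    have := monotone_nat_of_le_succ (g.mono i) (le_max_left m (i+1))
    rwa [g.top i _ (le_max_right _ _)] at this
  refine ⟨?_, ?_, fun j m => g.mono _ m, fun j m => g.strict _ m, ?_, ?_⟩
  · intro j m
    have : ∀ m j, m ≤ j → R (n+j) m ≤ 0 := by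
      intro m
      induction m with
      | zero => intro j _; rw [g.zero]; simp [addRect]
      | succ m ih =>
        intro j hj
        obtain ⟨j, rfl⟩ : ∃ t, j = t + 1 := ⟨j - 1, by omega⟩
        exact (g.strict (n+j) m).trans (ih j (by omega))
    intro h
    exact le_antisymm (this m j h) (g.nonneg _ _)
  · intro j m hmn
    show R (n+j) m = nu j
    by_cases hj : n ≤ j
    · have := ltop (n+j) m
      rw [nut, hv.2 j hj] at this
      rw [hv.2 j hj]
      exact le_antisymm this (g.nonneg _ _)
    have hs : ∀ t, R (n+j) (m+t+1) = R (n+j) (m+t) := by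
      intro t
      have h1 := g.content (m+t)
      have h2 : addRect n b mu (m+t) = 0 := by
        simp [addRect, show ¬ m + t < n by omega]
      rw [h2] at h1
      have hnn : ∀ x ∈ range (n+n), 0 ≤ R x (m+t+1) - R x (m+t) := by
        intro x _
        have := g.mono x (m+t)
        linarith
      have h3 : ∑ x ∈ range (n+n), (R x (m+t+1) - R x (m+t)) = 0 := by
        rw [sum_sub_distrib, h1]; simp
      have := (sum_eq_zero_iff_of_nonneg hnn).1 h3 (n+j) (mem_range.2 (by omega))
      linarith
    have hs2 : ∀ t, R (n+j) (m+t) = R (n+j) m := by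
      intro t
      induction t with
      | zero => rfl
      | succ t ih => rw [← add_assoc, hs, ih]
    rw [← hs2 (n+j+1), g.top _ _ (by omega), nut]
  · intro m d hd
    have h1 := g.content m
    rw [sum_range_add, sum_range_add, td m d hd] at h1
    have h2 : (addRect n b mu m : ℤ) = mu m + b := by
      simp [addRect, show m < n by omega]
    rw [h2] at h1
    linarith
  · intro j m d hd hj
    have h1 := g.ballot (n+j) m
    rw [add_assoc n j 1] at h1
    simp only [sum_range_add _ n] at h1
    have t1 := td (m+1) d (by omega)
    have t2 := td m (d+1) (by omega)
    rw [show m + 1 + 1 = m + 2 by ring] at t1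
    linarith

lemma RofQ_R (hl : MemParN n lam) (hm : MemParN n mu) (hv : MemParN n nu)
    (h1 : nu 0 ≤ a + b + k) (h2 : mu 0 ≤ a + k) (h3 : lam 0 ≤ b + k)
    {Q : ℕ → ℕ → ℤ} (q : QP n lam mu nu k Q) :
    GP (n+n) (addRect n a lam) (addRect n b mu) (prepend (a+b+k) n nu)
      (RofQ n lam a (a+b+k) Q) := by
  set R := RofQ n lam a (a+b+k) Q with hR
  have bot : ∀ j m, R (n+j) m = Q j m := by
    intro j m; simp [hR, RofQ]
  have ent : ∀ m d, m + d < n → R (m+d) m = lam d + a := by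
    intro m d h; simp [hR, RofQ, h]
  have tp : ∀ i m, i < n → i < m → R i m = ((a+b+k : ℕ) : ℤ) := by
    intro i m h h'
    simp only [hR, RofQ, h, if_true]
    rw [if_neg (by omega)]
  have shift : ∀ i m, i + 1 < n → R (i+1) (m+1) = R i m := by
    intro i m h
    by_cases him : i < m
    · rw [tp _ _ h (by omega), tp _ _ (by omega) him]
    · obtain ⟨d, rfl⟩ : ∃ d, i = m + d := ⟨i - m, by omega⟩
      rw [ent m d (by omega), show m + d + 1 = m + 1 + d by ring, ent (m+1) d (by omega)]
  have td : ∀ m d, m + d + 1 = n →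
      ∑ i ∈ range n, R i (m+1) = ∑ i ∈ range n, R i m + b + k - lam d := by
    intro m d hd
    rw [top_diff shift (fun m hn => tp 0 (m+1) hn (by omega)) m (m+d) hd, ent m d (by omega)]
    push_cast
    ring
  have td2 : ∀ m, n ≤ m → ∑ i ∈ range n, R i (m+1) = ∑ i ∈ range n, R i m := by
    intro m hmn
    apply sum_congr rfl
    intro i hi
    have := mem_range.1 hi
    rw [tp i (m+1) (by omega) (by omega), tp i m (by omega) (by omega)]
  have nut : ∀ j, prepend (a+b+k) n nu (n+j) = nu j := by
    intro j; simp [prepend]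
  have mono : ∀ i m, R i m ≤ R i (m+1) := by
    intro i m
    by_cases hi : i < n
    · by_cases him : i < m
      · rw [tp _ _ hi him, tp _ _ hi (by omega)]
      by_cases h : i = m
      · subst h
        have := ent i 0 (by omega)
        rw [add_zero] at this
        rw [this, tp _ _ hi (by omega)]
        push_cast
        have : (lam 0 : ℤ) ≤ b + k := by exact_mod_cast h3
        linarith
      obtain ⟨d, rfl⟩ : ∃ d, i = m + (d+1) := ⟨i - m - 1, by omega⟩
      rw [ent m (d+1) (by omega), show m + (d+1) = m+1+d by ring, ent (m+1) d (by omega)]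
      have : (lam (d+1) : ℤ) ≤ lam d := by exact_mod_cast hl.1.1 d (d+1) (by omega)
      linarith
    · obtain ⟨j, rfl⟩ : ∃ j, i = n + j := ⟨i - n, by omega⟩
      rw [bot, bot]; exact q.mono j m
  have q0 : ∀ m d, m + d + 1 = n → Q 0 (m+1) ≤ lam d + a := by
    intro m
    induction m with
    | zero =>
      intro d hd
      have := q.content 0 d (by omega)
      rw [sum_low q.low _ n (by omega), sum_low q.low _ n (by omega)] at this
      simp at this
      have h : (mu 0 : ℤ) ≤ a + k := by exact_mod_cast h2
      rw [zero_add, this]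
      linarith
    | succ m ih =>
      intro d hd
      have h := ih (d+1) (by omega)
      have h' := q.ballot 0 m d (by omega) (by omega)
      simp at h'
      rw [show m + 1 + 1 = m + 2 by ring]
      linarith
  have content : ∀ m, ∑ i ∈ range (n+n), R i (m+1) =
      ∑ i ∈ range (n+n), R i m + (addRect n b mu m : ℕ) := by
    intro m
    rw [sum_range_add, sum_range_add]
    simp only [bot]
    by_cases hmn : n ≤ m
    · rw [td2 m hmn]
      have e : ∀ j, Q j (m+1) = Q j m := by
        intro j
        rw [q.high j (m+1) (by omega), q.high j m hmn]
      simp [e, addRect, show ¬ m < n by omega]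
    · obtain ⟨d, hd⟩ : ∃ d, m + d + 1 = n := ⟨n - m - 1, by omega⟩
      rw [td m d hd, q.content m d hd]
      have h2 : (addRect n b mu m : ℤ) = mu m + b := by
        simp [addRect, show m < n by omega]
      rw [h2]
      ring
  refine ⟨?_, ?_, mono, ?_, content, ?_⟩
  · intro i
    by_cases hi : i < n
    · have := ent 0 i (by omega)
      rw [zero_add] at this
      rw [this]; simp [addRect, hi]
    · obtain ⟨j, rfl⟩ : ∃ j, i = n + j := ⟨i - n, by omega⟩
      rw [bot, q.low j 0 (by omega)]; simp [addRect]
  · intro i m him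
    by_cases hi : i < n
    · rw [tp i m hi (by omega)]; simp [prepend, hi]
    · obtain ⟨j, rfl⟩ : ∃ j, i = n + j := ⟨i - n, by omega⟩
      rw [bot, q.high j m (by omega), nut]
  · intro i m
    by_cases hi : i + 1 < n
    · rw [shift i m hi]
    by_cases hi2 : i + 1 = n
    · have := bot 0 (m+1)
      rw [add_zero] at this
      rw [hi2, this]
      by_cases hmn : n ≤ m
      · rw [q.high 0 _ (by omega), tp i m (by omega) (by omega)]
        exact_mod_cast h1
      · obtain ⟨d, rfl⟩ : ∃ d, i = m + d := ⟨i - m, by omega⟩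
        rw [ent m d (by omega)]
        exact q0 m d hi2
    · obtain ⟨j, rfl⟩ : ∃ j, i = n + j := ⟨i - n, by omega⟩
      rw [add_assoc, bot, bot]; exact q.strict j m
  · intro i m
    by_cases hi : i < n
    · have e : ∀ m, ∑ x ∈ range (i+1), R x (m+1) = ∑ x ∈ range i, R x m + (a+b+k : ℕ) := by
        intro m
        rw [sum_range_succ', tp 0 (m+1) (by omega) (by omega)]
        congr 1
        apply sum_congr rfl
        intro x hx
        have := mem_range.1 hx
        exact shift x m (by omega)
      have e1 := e m
      have e2 := e (m+1)
      rw [show m + 1 + 1 = m + 2 by ring] at e2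
      linarith
    · obtain ⟨j, rfl⟩ : ∃ j, i = n + j := ⟨i - n, by omega⟩
      by_cases hmn : n ≤ m + 1
      · have e : ∑ x ∈ range (n+j+1), R x (m+2) = ∑ x ∈ range (n+j+1), R x (m+1) := by
          rw [add_assoc n j 1, sum_range_add _ n, sum_range_add _ n, td2 (m+1) hmn]
          congr 1
          apply sum_congr rfl
          intro x _
          rw [bot, bot, q.high x _ (by omega), q.high x _ hmn]
        have e2 : ∑ x ∈ range (n+j), R x m ≤ ∑ x ∈ range (n+j), R x (m+1) :=
          sum_le_sum (fun x _ => mono x m)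
        linarith
      · obtain ⟨d, hd⟩ : ∃ d, m + d + 2 = n := ⟨n - m - 2, by omega⟩
        have t1 := td (m+1) d (by omega)
        have t2 := td m (d+1) (by omega)
        rw [show m + 1 + 1 = m + 2 by ring] at t1
        rw [add_assoc n j 1]
        simp only [sum_range_add _ n, bot]
        by_cases hj : j ≤ m
        · have := q.ballot j m d hd hj
          linarith
        · have c1 := q.content (m+1) d (by omega)
          have c2 := q.content m (d+1) (by omega)
          rw [show m + 1 + 1 = m + 2 by ring] at c1
          rw [sum_low q.low _ n (by omega), sum_low q.low _ n (by omega)] at c1 c2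
          rw [sum_low q.low _ (j+1) (by omega), sum_low q.low _ (j+1) (by omega),
            sum_low q.low _ j (by omega), sum_low q.low _ j (by omega)]
          have : (mu (m+1) : ℤ) ≤ mu m := by exact_mod_cast hm.1.1 m (m+1) (by omega)
          linarith

theorem card_R_QP (hl : MemParN n lam) (hm : MemParN n mu) (hv : MemParN n nu)
    (h1 : nu 0 ≤ a + b + k) (h2 : mu 0 ≤ a + k) (h3 : lam 0 ≤ b + k) :
    Nat.card {R : ℕ → ℕ → ℤ //
        GP (n+n) (addRect n a lam) (addRect n b mu) (prepend (a+b+k) n nu) R} =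
      Nat.card {Q : ℕ → ℕ → ℤ // QP n lam mu nu k Q} := by
  refine Nat.card_congr ⟨fun R => ⟨fun j m => R.1 (n+j) m, R_QP hm hv R.2⟩,
    fun Q => ⟨RofQ n lam a (a+b+k) Q.1, RofQ_R hl hm hv h1 h2 h3 Q.2⟩, ?_, ?_⟩
  · rintro ⟨R, g⟩
    apply Subtype.ext
    funext i m
    simp only [RofQ]
    split_ifs with hi him
    · obtain ⟨d, rfl⟩ : ∃ d, i = m + d := ⟨i - m, by omega⟩
      rw [forced_entry g m d hi]
      simp
    · rw [g.top i m (by omega)]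
      simp [prepend, hi]
    · rw [show n + (i - n) = i by omega]
  · rintro ⟨Q, q⟩
    apply Subtype.ext
    funext j m
    simp [RofQ]

end BQ

/-- **Lemma.** For `λ,μ,ν ∈ Par_n` and `a,b,k ≥ 0` with `ν₁ ≤ a+b+k`,
`μ₁ ≤ a+k`, `λ₁ ≤ b+k`, one has
`c^{(a+b+k)^n ∪ ν}_{λ+a^n, μ+b^n} = c^{ν+k^n}_{λ,μ}`. -/
theorem stmt8 (n : ℕ) (lam mu nu : ℕ → ℕ)
    (hl : MemParN n lam) (hm : MemParN n mu) (hv : MemParN n nu)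
    (a b k : ℕ) (h1 : nu 0 ≤ a + b + k) (h2 : mu 0 ≤ a + k) (h3 : lam 0 ≤ b + k) :
    lrCoeff (addRect n a lam) (addRect n b mu) (prepend (a + b + k) n nu) =
      lrCoeff lam mu (addRect n k nu) := by
  rw [lr_eq_GP (n+n) _ _ _ ?_ (part_addRect a hl) (part_addRect b hm) (part_prepend hv h1),
    lr_eq_GP n _ _ _ ?_ hl.1 hm.1 (part_addRect k hv),
    card_R_QP hl hm hv h1 h2 h3, card_GP_QP hl hm hv]
  · intro i hi
    simp [addRect, hi]
  · intro i hi
    unfold prepend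
    rw [if_neg (by omega)]
    exact hv.2 _ (by omega)
end
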